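/- arXiv:2111.09617 — 14 statements merged into one kernel-verified Lean document; each statement's English description precedes it below -/
import Mathlib

section
/- Let ω ∈ (0, π) and let η_l, τ_l, η_r, τ_r ∈ ℝ with ε_l := η_l² − τ_l² ≠ −4 and ε_r := η_r² − τ_r² ≠ −4, and set p_j := 1 + ε_j/4, m_j := 1 − ε_j/4 for j = l, r. Let ν_l := (−sin ω, cos ω) and ν_r := (−sin ω, −cos ω). Then for all u₊, u₋ ∈ ℂ²: (a) −i(ν_{l,1}σ₁ + ν_{l,2}σ₂)(u₊ − u₋) = (1/2)(η_l σ₀ + τ_l σ₃)(u₊ + u₋) holds if and only if u₋ = (1/p_l)·[[m_l, −e^{−iω}(η_l − τ_l)], [e^{iω}(η_l + τ_l), m_l]]·u₊; and (b) −i(ν_{r,1}σ₁ + ν_{r,2}σ₂)(u₊ − u₋) = (1/2)(η_r σ₀ + τ_r σ₃)(u₊ + u₋) holds if and only if u₋ = (1/p_r)·[[m_r, e^{iω}(η_r − τ_r)], [−e^{−iω}(η_r + τ_r), m_r]]·u₊. -/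
noncomputable section

open Matrix

/-- A transmission condition with off-diagonal coefficient `!![0, -w; z, 0]`, where `z * w = 1`,
solved for the trace `um`. -/
lemma transmission_condition_iff {z w η τ : ℂ} (hzw : z * w = 1)
    (hp : 1 + (η ^ 2 - τ ^ 2) / 4 ≠ 0) (up um : Fin 2 → ℂ) :
    !![0, -w; z, 0] *ᵥ (up - um) =
        ((1 / 2 : ℂ) • (η • (1 : Matrix (Fin 2) (Fin 2) ℂ) + τ • !![1, 0; 0, -1])) *ᵥ (up + um) ↔
      um = ((1 + (η ^ 2 - τ ^ 2) / 4)⁻¹ •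
        !![1 - (η ^ 2 - τ ^ 2) / 4, -w * (η - τ); z * (η + τ), 1 - (η ^ 2 - τ ^ 2) / 4]) *ᵥ up := by
  rw [Matrix.smul_mulVec _ _ up, eq_inv_smul_iff₀ hp]
  simp only [funext_iff, Fin.forall_fin_two, Matrix.mulVec, dotProduct, Fin.sum_univ_two,
    Matrix.smul_apply, Matrix.add_apply, Matrix.one_apply, Matrix.of_apply, Matrix.cons_val',
    Matrix.cons_val_zero, Matrix.cons_val_one, Matrix.cons_val_fin_one, Pi.sub_apply,
    Pi.add_apply, Pi.smul_apply, smul_eq_mul]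
  norm_num
  generalize up 0 = a, up 1 = b, um 0 = c, um 1 = d
  constructor
  · rintro ⟨h₁, h₂⟩
    constructor
    · linear_combination -(η - τ) / 2 * h₁ - w * h₂ + (a - c) * hzw
    · linear_combination z * h₁ - (η + τ) / 2 * h₂ + (b - d) * hzw
  · rintro ⟨h₁, h₂⟩
    constructor <;> refine mul_left_cancel₀ hp ?_
    · linear_combination -(η + τ) / 2 * h₁ + w * h₂ + (η + τ) * a * hzw
    · linear_combination -z * h₁ - (η - τ) / 2 * h₂ + (η - τ) * b * hzw

/-- The condition `η ^ 2 - τ ^ 2 ≠ -4` as nonvanishing of the complex denominator. -/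
lemma one_add_div_four_ne_zero {η τ : ℝ} (h : η ^ 2 - τ ^ 2 ≠ -4) :
    1 + ((η : ℂ) ^ 2 - (τ : ℂ) ^ 2) / 4 ≠ 0 := by
  norm_cast
  contrapose! h
  linarith

/-- pointwise form of the transmission boundary condition on the two
edges of a broken line with half-angle `ω`, with electrostatic strengths `ηl, ηr`
and Lorentz-scalar strengths `τl, τr`. -/
theorem broken_line_boundary_condition_equiv
    (ω ηl τl ηr τr : ℝ) (hω : ω ∈ Set.Ioo 0 Real.pi)
    (hεl : ηl ^ 2 - τl ^ 2 ≠ -4) (hεr : ηr ^ 2 - τr ^ 2 ≠ -4) :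
    let σ0 : Matrix (Fin 2) (Fin 2) ℂ := 1
    let σ1 : Matrix (Fin 2) (Fin 2) ℂ := !![0, 1; 1, 0]
    let σ2 : Matrix (Fin 2) (Fin 2) ℂ := !![0, -Complex.I; Complex.I, 0]
    let σ3 : Matrix (Fin 2) (Fin 2) ℂ := !![1, 0; 0, -1]
    let pl : ℝ := 1 + (ηl ^ 2 - τl ^ 2) / 4
    let ml : ℝ := 1 - (ηl ^ 2 - τl ^ 2) / 4
    let pr : ℝ := 1 + (ηr ^ 2 - τr ^ 2) / 4
    let mr : ℝ := 1 - (ηr ^ 2 - τr ^ 2) / 4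
    let Ml : Matrix (Fin 2) (Fin 2) ℂ :=
      ((pl : ℂ))⁻¹ •
        !![(ml : ℂ), -Complex.exp (-(Complex.I * (ω : ℂ))) * ((ηl : ℂ) - (τl : ℂ));
           Complex.exp (Complex.I * (ω : ℂ)) * ((ηl : ℂ) + (τl : ℂ)), (ml : ℂ)]
    let Mr : Matrix (Fin 2) (Fin 2) ℂ :=
      ((pr : ℂ))⁻¹ •
        !![(mr : ℂ), Complex.exp (Complex.I * (ω : ℂ)) * ((ηr : ℂ) - (τr : ℂ));
           -Complex.exp (-(Complex.I * (ω : ℂ))) * ((ηr : ℂ) + (τr : ℂ)), (mr : ℂ)]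
    ∀ up um : Fin 2 → ℂ,
      -- (a) the condition on the left edge, with normal ν_l = (−sin ω, cos ω)
      (((-Complex.I) •
          (((-Real.sin ω : ℝ) : ℂ) • σ1 + ((Real.cos ω : ℝ) : ℂ) • σ2)).mulVec (up - um) =
        ((1 / 2 : ℂ) • ((ηl : ℂ) • σ0 + (τl : ℂ) • σ3)).mulVec (up + um)
        ↔ um = Ml.mulVec up) ∧
      -- (b) the condition on the right edge, with normal ν_r = (−sin ω, −cos ω)
      (((-Complex.I) •
          (((-Real.sin ω : ℝ) : ℂ) • σ1 + ((-Real.cos ω : ℝ) : ℂ) • σ2)).mulVec (up - um) =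
        ((1 / 2 : ℂ) • ((ηr : ℂ) • σ0 + (τr : ℂ) • σ3)).mulVec (up + um)
        ↔ um = Mr.mulVec up) := by
  intro σ0 σ1 σ2 σ3 pl ml pr mr Ml Mr up um
  have hexp : Complex.exp (Complex.I * ω) * Complex.exp (-(Complex.I * ω)) = 1 := by
    rw [← Complex.exp_add, add_neg_cancel, Complex.exp_zero]
  have hpos : Complex.exp (Complex.I * ω) = Complex.cos ω + Complex.sin ω * Complex.I := by
    rw [mul_comm, Complex.exp_mul_I]
  have hneg : Complex.exp (-(Complex.I * ω)) = Complex.cos ω - Complex.sin ω * Complex.I := by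
    rw [mul_comm, ← neg_mul, Complex.exp_mul_I, Complex.cos_neg, Complex.sin_neg, neg_mul,
      sub_eq_add_neg]
  constructor
  · convert transmission_condition_iff hexp (one_add_div_four_ne_zero hεl) up um using 3
    · ext i j
      fin_cases i <;> fin_cases j <;> simp [σ1, σ2, hpos, hneg] <;> grind [Complex.I_mul_I]
    · simp [Ml, pl, ml]
  · convert transmission_condition_iff
      (z := -Complex.exp (-(Complex.I * ω))) (w := -Complex.exp (Complex.I * ω))
      (by linear_combination hexp) (one_add_div_four_ne_zero hεr) up um using 3
    · ext i j
      fin_cases i <;> fin_cases j <;> simp [σ1, σ2, hpos, hneg] <;> grind [Complex.I_mul_I]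
    · simp [Mr, pr, mr]
end
end

section
/- Let ω ∈ (0, π) and let η, τ ∈ ℝ with ε := η² − τ² ≠ −4, and set p := 1 + ε/4, m := 1 − ε/4. Let ν_l := (−sin ω, cos ω), ν_r := (−sin ω, −cos ω), and define M_l := (1/p)·[[m, −e^{−iω}(η − τ)], [e^{iω}(η + τ), m]] and M_r := (1/p)·[[m, e^{iω}(η − τ)], [−e^{−iω}(η + τ), m]]. Then M_l* (ν_{l,1}σ₁ + ν_{l,2}σ₂) M_l = ν_{l,1}σ₁ + ν_{l,2}σ₂ and M_r* (ν_{r,1}σ₁ + ν_{r,2}σ₂) M_r = ν_{r,1}σ₁ + ν_{r,2}σ₂, where * denotes the conjugate transpose. -/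
noncomputable section

open Matrix

/-- For unimodular `u`, the boundary matrix with phase `u` preserves the off-diagonal Hermitian
matrix with entries `-i ū` and `i u`. -/
lemma conjTranspose_mul_mul_eq_of_unimodular (u : ℂ) (hu : u * star u = 1) (p m a b : ℝ)
    (hp : p ≠ 0) (h : m ^ 2 + a * b = p ^ 2) :
    ((p : ℂ)⁻¹ • !![(m : ℂ), -star u * a; u * b, (m : ℂ)])ᴴ *
        !![0, -Complex.I * star u; Complex.I * u, 0] *
        ((p : ℂ)⁻¹ • !![(m : ℂ), -star u * a; u * b, (m : ℂ)]) =
      !![0, -Complex.I * star u; Complex.I * u, 0] := by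
  have hpc : (p : ℂ) ≠ 0 := Complex.ofReal_ne_zero.mpr hp
  have hc : (m : ℂ) ^ 2 + a * b = (p : ℂ) ^ 2 := by exact_mod_cast h
  have key : !![(m : ℂ), -star u * a; u * b, (m : ℂ)]ᴴ *
      !![0, -Complex.I * star u; Complex.I * u, 0] * !![(m : ℂ), -star u * a; u * b, (m : ℂ)] =
      (p : ℂ) ^ 2 • !![0, -Complex.I * star u; Complex.I * u, 0] := by
    rw [← hc]
    ext i j
    fin_cases i <;> fin_cases j <;>
      simp [Matrix.mul_apply, Fin.sum_univ_two] at hu ⊢ <;> grind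
  rw [Matrix.conjTranspose_smul, Matrix.smul_mul, Matrix.smul_mul, Matrix.mul_smul, key,
    smul_smul, smul_smul]
  have hs : star ((p : ℂ)⁻¹) = (p : ℂ)⁻¹ := by simp
  rw [hs, show (p : ℂ)⁻¹ * (p : ℂ)⁻¹ * (p : ℂ) ^ 2 = 1 by field_simp, one_smul]

/-- the boundary-condition matrices `M_l`, `M_r` of the broken line
satisfy `M* (σ·ν) M = σ·ν` for the corresponding outward normals. -/
theorem boundary_matrices_preserve_sigma_nu
    (ω η τ : ℝ) (hω : ω ∈ Set.Ioo 0 Real.pi) (hε : η ^ 2 - τ ^ 2 ≠ -4) :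
    let σ1 : Matrix (Fin 2) (Fin 2) ℂ := !![0, 1; 1, 0]
    let σ2 : Matrix (Fin 2) (Fin 2) ℂ := !![0, -Complex.I; Complex.I, 0]
    let p : ℝ := 1 + (η ^ 2 - τ ^ 2) / 4
    let m : ℝ := 1 - (η ^ 2 - τ ^ 2) / 4
    let Ml : Matrix (Fin 2) (Fin 2) ℂ :=
      ((p : ℂ))⁻¹ •
        !![(m : ℂ), -Complex.exp (-(Complex.I * (ω : ℂ))) * ((η : ℂ) - (τ : ℂ));
           Complex.exp (Complex.I * (ω : ℂ)) * ((η : ℂ) + (τ : ℂ)), (m : ℂ)]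
    let Mr : Matrix (Fin 2) (Fin 2) ℂ :=
      ((p : ℂ))⁻¹ •
        !![(m : ℂ), Complex.exp (Complex.I * (ω : ℂ)) * ((η : ℂ) - (τ : ℂ));
           -Complex.exp (-(Complex.I * (ω : ℂ))) * ((η : ℂ) + (τ : ℂ)), (m : ℂ)]
    let Al : Matrix (Fin 2) (Fin 2) ℂ :=
      ((-Real.sin ω : ℝ) : ℂ) • σ1 + ((Real.cos ω : ℝ) : ℂ) • σ2
    let Ar : Matrix (Fin 2) (Fin 2) ℂ :=
      ((-Real.sin ω : ℝ) : ℂ) • σ1 + ((-Real.cos ω : ℝ) : ℂ) • σ2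
    Ml.conjTranspose * Al * Ml = Al ∧ Mr.conjTranspose * Ar * Mr = Ar := by
  intro σ1 σ2 p m Ml Mr Al Ar
  have hp : p ≠ 0 := fun h => hε (by simp only [p] at h; linarith)
  have hm : m ^ 2 + (η - τ) * (η + τ) = p ^ 2 := by simp only [p, m]; ring
  have hstar : star (Complex.exp (Complex.I * ω)) = Complex.exp (-(Complex.I * ω)) := by
    simp [← Complex.exp_conj]
  have hunit : Complex.exp (Complex.I * ω) * Complex.exp (-(Complex.I * ω)) = 1 := by
    rw [← Complex.exp_add, add_neg_cancel, Complex.exp_zero]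
  have hstar' : star (Complex.exp (-(Complex.I * ω))) = Complex.exp (Complex.I * ω) := by
    rw [← hstar, star_star]
  have hexp : Complex.exp (Complex.I * ω) = Complex.cos ω + Complex.sin ω * Complex.I := by
    rw [mul_comm, Complex.exp_mul_I]
  have hexp' : Complex.exp (-(Complex.I * ω)) = Complex.cos ω - Complex.sin ω * Complex.I := by
    rw [mul_comm, ← neg_mul, Complex.exp_mul_I, Complex.cos_neg, Complex.sin_neg]
    ring
  have hI := Complex.I_mul_I
  have hAl : Al = !![0, -Complex.I * Complex.exp (-(Complex.I * ω));
      Complex.I * Complex.exp (Complex.I * ω), 0] := by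
    rw [hexp, hexp']
    ext i j
    fin_cases i <;> fin_cases j <;> simp [Al, σ1, σ2] <;> grind
  have hAr : Ar = !![0, Complex.I * Complex.exp (Complex.I * ω);
      -Complex.I * Complex.exp (-(Complex.I * ω)), 0] := by
    rw [hexp, hexp']
    ext i j
    fin_cases i <;> fin_cases j <;> simp [Ar, σ1, σ2] <;> grind
  constructor
  · have h := conjTranspose_mul_mul_eq_of_unimodular (Complex.exp (Complex.I * ω))
      (by rw [hstar, hunit]) p m (η - τ) (η + τ) hp hm
    rw [hstar] at h
    rw [hAl]
    simpa only [Ml, Complex.ofReal_sub, Complex.ofReal_add] using h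
  · have h := conjTranspose_mul_mul_eq_of_unimodular (-Complex.exp (-(Complex.I * ω)))
      (by rw [star_neg, hstar', neg_mul_neg, mul_comm, hunit]) p m (η - τ) (η + τ) hp hm
    rw [star_neg, hstar', neg_neg, neg_mul_neg, mul_neg, ← neg_mul Complex.I (Complex.exp _)] at h
    rw [hAr]
    simpa only [Mr, Complex.ofReal_sub, Complex.ofReal_add] using h
end
end

section
/- Let ω ∈ (0, π) and let η_l, τ_l, η_r, τ_r ∈ ℝ with ε_l := η_l² − τ_l² and ε_r := η_r² − τ_r² satisfying ε_l ≠ ±4 and ε_r ≠ ±4. Set p_j := 1 + ε_j/4, m_j := 1 − ε_j/4 for j = l, r, and let 𝒰 be the 4×4 complex matrix whose only possibly nonzero entries are 𝒰₁₂ = −e^{iω}(η_r − τ_r)/m_r, 𝒰₁₃ = p_r/m_r, 𝒰₂₁ = −e^{iω}(η_l + τ_l)/m_l, 𝒰₂₄ = p_l/m_l, 𝒰₃₁ = p_l/m_l, 𝒰₃₄ = −e^{−iω}(η_l − τ_l)/m_l, 𝒰₄₂ = p_r/m_r, 𝒰₄₃ = −e^{−iω}(η_r + τ_r)/m_r. Then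 𝒰 is unitary if and only if η_l = 0 and η_r = 0. -/
noncomputable section

open Matrix

/-- A phase `exp (iω)` with `ω` real is conjugated to its inverse phase. -/
lemma star_exp_I_mul_ofReal (ω : ℝ) :
    (starRingEnd ℂ) (Complex.exp (Complex.I * (ω : ℂ))) =
      Complex.exp (-(Complex.I * (ω : ℂ))) := by
  rw [← Complex.exp_conj]
  simp

lemma star_exp_neg_I_mul_ofReal (ω : ℝ) :
    (starRingEnd ℂ) (Complex.exp (-(Complex.I * (ω : ℂ)))) =
      Complex.exp (Complex.I * (ω : ℂ)) := by
  rw [← star_exp_I_mul_ofReal, Complex.conj_conj]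

/-- The off-diagonal entry of `U * star U` belonging to one half-line vanishes only if the
electrostatic strength does. -/
lemma electrostatic_eq_zero_of_row_orthogonal {z : ℂ} {η a b p m : ℝ} (hz : z ≠ 0)
    (hp : p ≠ 0) (hm : m ≠ 0) (hab : a + b = 2 * η)
    (h : -(z * (a : ℂ)) / m * (p / m) + p / m * (-(z * (b : ℂ)) / m) = 0) : η = 0 := by
  have hm' : (m : ℂ) ≠ 0 := by exact_mod_cast hm
  have hp' : (p : ℂ) ≠ 0 := by exact_mod_cast hp
  have hab' : (a : ℂ) + b = 2 * η := by exact_mod_cast hab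
  have hprod : z * p * (2 * (η : ℂ)) = 0 := by
    rw [← hab']
    field_simp at h
    linear_combination -h
  simpa [hz, hp'] using hprod

/-- the vertex scattering matrix `𝒰` of the spin-orbit operator
`J − 1/2` on the broken line is unitary if and only if the electrostatic
interaction strengths vanish. -/
theorem scattering_matrix_unitary_iff_no_electrostatic
    (ω ηl τl ηr τr : ℝ) (hω : ω ∈ Set.Ioo 0 Real.pi)
    (hεl : ηl ^ 2 - τl ^ 2 ≠ 4) (hεl' : ηl ^ 2 - τl ^ 2 ≠ -4)
    (hεr : ηr ^ 2 - τr ^ 2 ≠ 4) (hεr' : ηr ^ 2 - τr ^ 2 ≠ -4) :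
    let pl : ℝ := 1 + (ηl ^ 2 - τl ^ 2) / 4
    let ml : ℝ := 1 - (ηl ^ 2 - τl ^ 2) / 4
    let pr : ℝ := 1 + (ηr ^ 2 - τr ^ 2) / 4
    let mr : ℝ := 1 - (ηr ^ 2 - τr ^ 2) / 4
    let U : Matrix (Fin 4) (Fin 4) ℂ :=
      !![0, -Complex.exp (Complex.I * (ω : ℂ)) * ((ηr : ℂ) - (τr : ℂ)) / (mr : ℂ),
           (pr : ℂ) / (mr : ℂ), 0;
         -Complex.exp (Complex.I * (ω : ℂ)) * ((ηl : ℂ) + (τl : ℂ)) / (ml : ℂ), 0, 0,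
           (pl : ℂ) / (ml : ℂ);
         (pl : ℂ) / (ml : ℂ), 0, 0,
           -Complex.exp (-(Complex.I * (ω : ℂ))) * ((ηl : ℂ) - (τl : ℂ)) / (ml : ℂ);
         0, (pr : ℂ) / (mr : ℂ),
           -Complex.exp (-(Complex.I * (ω : ℂ))) * ((ηr : ℂ) + (τr : ℂ)) / (mr : ℂ), 0]
    U ∈ Matrix.unitaryGroup (Fin 4) ℂ ↔ ηl = 0 ∧ ηr = 0 := by
  intro pl ml pr mr U
  have hpl : pl ≠ 0 := fun h => hεl' (by simp only [pl] at h; linarith)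
  have hml : ml ≠ 0 := fun h => hεl (by simp only [ml] at h; linarith)
  have hpr : pr ≠ 0 := fun h => hεr' (by simp only [pr] at h; linarith)
  have hmr : mr ≠ 0 := fun h => hεr (by simp only [mr] at h; linarith)
  have hz := Complex.exp_ne_zero (Complex.I * (ω : ℂ))
  have hzw : Complex.exp (Complex.I * (ω : ℂ)) * Complex.exp (-(Complex.I * (ω : ℂ))) = 1 := by
    rw [← Complex.exp_add, add_neg_cancel, Complex.exp_zero]
  have hconj := star_exp_I_mul_ofReal ω
  have hconj' := star_exp_neg_I_mul_ofReal ω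
  rw [Matrix.mem_unitaryGroup_iff]
  constructor
  · intro h
    have hl := congrFun (congrFun h 1) 2
    have hr := congrFun (congrFun h 0) 3
    simp [U, Matrix.mul_apply, Fin.sum_univ_four, Matrix.star_apply, hconj', -mul_eq_zero,
      -div_eq_zero_iff] at hl hr
    refine ⟨electrostatic_eq_zero_of_row_orthogonal (a := ηl + τl) (b := ηl - τl)
        hz hpl hml (by ring) ?_,
      electrostatic_eq_zero_of_row_orthogonal (a := ηr - τr) (b := ηr + τr)
        hz hpr hmr (by ring) ?_⟩
    · push_cast
      exact hl
    · push_cast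
      exact hr
  · rintro ⟨rfl, rfl⟩
    have hml' : (ml : ℂ) ≠ 0 := by exact_mod_cast hml
    have hmr' : (mr : ℂ) ≠ 0 := by exact_mod_cast hmr
    have hl : (τl : ℂ) ^ 2 + pl ^ 2 = ml ^ 2 := by
      simp only [pl, ml]
      push_cast
      ring
    have hr : (τr : ℂ) ^ 2 + pr ^ 2 = mr ^ 2 := by
      simp only [pr, mr]
      push_cast
      ring
    clear_value pl ml pr mr
    ext i j
    fin_cases i <;> fin_cases j <;>
      simp [U, Matrix.mul_apply, Fin.sum_univ_four, Matrix.star_apply, hconj, hconj',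
        -mul_eq_zero, -div_eq_zero_iff] <;>
      field_simp <;>
      first
        | ring1
        | linear_combination hl + (τl : ℂ) ^ 2 * hzw
        | linear_combination hr + (τr : ℂ) ^ 2 * hzw
end
end

section
/- Let τ_l, τ_r ∈ ℝ with τ_l ≠ ±2 and τ_r ≠ ±2, let ω ∈ (0, π) and λ ∈ ℝ. Then the broken-line eigenvalue system with parameters (τ_l, τ_r, ω, λ) has a nonzero solution (c₊₁, c₊₂, c₋₁, c₋₂) ∈ ℂ⁴ if and only if 1 − (m(τ_l)·m(τ_r)/(p(τ_l)·p(τ_r)))·cos(2πλ) − (τ_l·τ_r/(p(τ_l)·p(τ_r)))·cos(2ω(2λ+1) − 2πλ) = 0. -/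
noncomputable section

/-- `p(τ) = 1 − τ²/4`. -/
def brokenP (τ : ℝ) : ℝ := 1 - τ ^ 2 / 4

/-- `m(τ) = 1 + τ²/4`. -/
def brokenM (τ : ℝ) : ℝ := 1 + τ ^ 2 / 4

/-- The broken-line eigenvalue system with Lorentz-scalar strengths `τl, τr`,
half-angle `ω` and spectral parameter `lam`, in the unknowns
`(cp1, cp2, cm1, cm2) ∈ ℂ⁴`. -/
def BrokenLineSystem (τl τr ω lam : ℝ) (cp1 cp2 cm1 cm2 : ℂ) : Prop :=
  cm1 = ((brokenM τl / brokenP τl : ℝ) : ℂ) * cp1 +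
        ((τl / brokenP τl : ℝ) : ℂ) *
          Complex.exp (-(Complex.I * ((ω * (2 * lam + 1) : ℝ) : ℂ))) * cp2 ∧
  cm2 = ((τl / brokenP τl : ℝ) : ℂ) *
          Complex.exp (Complex.I * ((ω * (2 * lam + 1) : ℝ) : ℂ)) * cp1 +
        ((brokenM τl / brokenP τl : ℝ) : ℂ) * cp2 ∧
  cm1 = ((brokenM τr / brokenP τr : ℝ) : ℂ) *
          Complex.exp (-(2 * (Real.pi : ℂ) * Complex.I * (lam : ℂ))) * cp1 -
        ((τr / brokenP τr : ℝ) : ℂ) *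
          Complex.exp (Complex.I * ((ω * (2 * lam + 1) - 2 * Real.pi * lam : ℝ) : ℂ)) * cp2 ∧
  cm2 = -((τr / brokenP τr : ℝ) : ℂ) *
          Complex.exp (-(Complex.I * ((ω * (2 * lam + 1) - 2 * Real.pi * lam : ℝ) : ℂ))) * cp1 +
        ((brokenM τr / brokenP τr : ℝ) : ℂ) *
          Complex.exp (2 * (Real.pi : ℂ) * Complex.I * (lam : ℂ)) * cp2

/-- A homogeneous `2 × 2` linear system over a field has a nonzero solution iff its determinant
vanishes. -/
theorem exists_ne_zero_two_by_two_iff {K : Type*} [Field K] (a b c d : K) :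
    (∃ x y : K, ¬(x = 0 ∧ y = 0) ∧ a * x + b * y = 0 ∧ c * x + d * y = 0) ↔
      a * d - b * c = 0 := by
  rw [← Matrix.det_fin_two_of, ← Matrix.exists_mulVec_eq_zero_iff]
  constructor
  · rintro ⟨x, y, hxy, h₁, h₂⟩
    refine ⟨![x, y], fun h => hxy ⟨congrFun h 0, congrFun h 1⟩, ?_⟩
    ext i
    fin_cases i
    · simpa [Matrix.mulVec, dotProduct] using h₁
    · simpa [Matrix.mulVec, dotProduct] using h₂
  · rintro ⟨v, hv, h⟩
    refine ⟨v 0, v 1, fun h' => hv ?_, ?_, ?_⟩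
    · ext i
      fin_cases i <;> simp [h']
    · simpa [Matrix.mulVec, dotProduct] using congrFun h 0
    · simpa [Matrix.mulVec, dotProduct] using congrFun h 1

theorem brokenP_ne_zero {τ : ℝ} (h : τ ≠ 2) (h' : τ ≠ -2) : brokenP τ ≠ 0 := by
  intro h₀
  have : (τ - 2) * (τ + 2) = 0 := by
    unfold brokenP at h₀
    linarith
  rcases mul_eq_zero.mp this with h₁ | h₁
  · exact h (by linarith)
  · exact h' (by linarith)

theorem brokenM_div_sq_sub_div_sq {τ : ℝ} (h : τ ≠ 2) (h' : τ ≠ -2) :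
    (brokenM τ / brokenP τ) ^ 2 - (τ / brokenP τ) ^ 2 = 1 := by
  have hp := brokenP_ne_zero h h'
  field_simp
  unfold brokenM brokenP
  ring

/-- Eliminating `c₋` from a system of the form `c₋ = L c₊ = R c₊`. -/
theorem exists_ne_zero_eliminate_iff {K : Type*} [Field K] (a b c d a' b' c' d' : K) :
    (∃ x y z w : K, ¬(x = 0 ∧ y = 0 ∧ z = 0 ∧ w = 0) ∧
        z = a * x + b * y ∧ w = c * x + d * y ∧ z = a' * x + b' * y ∧ w = c' * x + d' * y) ↔
      (a - a') * (d - d') - (b - b') * (c - c') = 0 := by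
  rw [← exists_ne_zero_two_by_two_iff]
  constructor
  · rintro ⟨x, y, z, w, hne, h₁, h₂, h₃, h₄⟩
    refine ⟨x, y, ?_, by linear_combination h₃ - h₁, by linear_combination h₄ - h₂⟩
    rintro ⟨rfl, rfl⟩
    exact hne ⟨rfl, rfl, by simpa using h₁, by simpa using h₂⟩
  · rintro ⟨x, y, hne, h₁, h₂⟩
    exact ⟨x, y, _, _, fun h => hne ⟨h.1, h.2.1⟩, rfl, rfl,
      by linear_combination h₁, by linear_combination h₂⟩

/-- the broken-line eigenvalue system has a nonzero solution iff
the eigenvalue equation holds. -/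
theorem brokenLineSystem_nonzero_solution_iff
    (τl τr ω lam : ℝ) (hl : τl ≠ 2) (hl' : τl ≠ -2) (hr : τr ≠ 2) (hr' : τr ≠ -2)
    (hω : ω ∈ Set.Ioo 0 Real.pi) :
    (∃ cp1 cp2 cm1 cm2 : ℂ, ¬(cp1 = 0 ∧ cp2 = 0 ∧ cm1 = 0 ∧ cm2 = 0) ∧
        BrokenLineSystem τl τr ω lam cp1 cp2 cm1 cm2) ↔
      1 - brokenM τl * brokenM τr / (brokenP τl * brokenP τr) * Real.cos (2 * Real.pi * lam)
        - τl * τr / (brokenP τl * brokenP τr) *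
            Real.cos (2 * ω * (2 * lam + 1) - 2 * Real.pi * lam) = 0 := by
  set Ml : ℝ := brokenM τl / brokenP τl
  set Mr : ℝ := brokenM τr / brokenP τr
  set Tl : ℝ := τl / brokenP τl
  set Tr : ℝ := τr / brokenP τr
  set α : ℝ := ω * (2 * lam + 1) with hα
  set θ : ℝ := 2 * Real.pi * lam with hθ
  have hl₁ : (Ml : ℂ) ^ 2 - (Tl : ℂ) ^ 2 = 1 := by
    exact_mod_cast brokenM_div_sq_sub_div_sq hl hl'
  have hr₁ : (Mr : ℂ) ^ 2 - (Tr : ℂ) ^ 2 = 1 := by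
    exact_mod_cast brokenM_div_sq_sub_div_sq hr hr'
  have hM : brokenM τl * brokenM τr / (brokenP τl * brokenP τr) = Ml * Mr :=
    mul_div_mul_comm _ _ _ _
  have hT : τl * τr / (brokenP τl * brokenP τr) = Tl * Tr := mul_div_mul_comm _ _ _ _
  have hφ : 2 * ω * (2 * lam + 1) - θ = 2 * α - θ := by rw [hα]; ring
  rw [hM, hT, hφ]
  set u := Complex.exp (Complex.I * α) with hu
  set u' := Complex.exp (-(Complex.I * α)) with hu'
  set v := Complex.exp (Complex.I * θ) with hv
  set v' := Complex.exp (-(Complex.I * θ)) with hv'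
  have huu : u * u' = 1 := by rw [hu, hu', ← Complex.exp_add]; simp
  have hvv : v * v' = 1 := by rw [hv, hv', ← Complex.exp_add]; simp
  have hcosθ : 2 * Complex.cos θ = v + v' := by
    rw [Complex.two_cos, hv, hv', mul_comm Complex.I, neg_mul]
  have hcosφ : 2 * Complex.cos (2 * α - θ) = u * u * v' + u' * u' * v := by
    rw [Complex.two_cos, hu, hu', hv, hv', ← Complex.exp_add, ← Complex.exp_add,
      ← Complex.exp_add, ← Complex.exp_add]
    ring_nf
  have hexp : Complex.exp (2 * Real.pi * Complex.I * lam) = v := by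
    rw [hv, hθ]; push_cast; ring_nf
  have hexp' : Complex.exp (-(2 * Real.pi * Complex.I * lam)) = v' := by
    rw [hv', hθ]; push_cast; ring_nf
  have hd : Complex.exp (Complex.I * ((α - θ : ℝ) : ℂ)) = u * v' := by
    rw [hu, hv', ← Complex.exp_add]; push_cast; ring_nf
  have hd' : Complex.exp (-(Complex.I * ((α - θ : ℝ) : ℂ))) = u' * v := by
    rw [hu', hv, ← Complex.exp_add]; push_cast; ring_nf
  have hsys (x y z w : ℂ) : BrokenLineSystem τl τr ω lam x y z w ↔
      z = Ml * x + Tl * u' * y ∧ w = Tl * u * x + Ml * y ∧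
        z = Mr * v' * x + -(Tr * (u * v')) * y ∧ w = -Tr * (u' * v) * x + Mr * v * y := by
    rw [BrokenLineSystem, hexp, hexp', hd, hd', neg_mul (Tr * (u * v') : ℂ), ← sub_eq_add_neg]
  simp only [hsys]
  rw [exists_ne_zero_eliminate_iff]
  have hdet : ((Ml : ℂ) - Mr * v') * (Ml - Mr * v) -
      (Tl * u' - -(Tr * (u * v'))) * (Tl * u - -Tr * (u' * v)) =
      2 * ((1 - Ml * Mr * Real.cos θ - Tl * Tr * Real.cos (2 * α - θ) : ℝ) : ℂ) := by
    push_cast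
    linear_combination hl₁ + hr₁ + Ml * Mr * hcosθ + Tl * Tr * hcosφ - Tl ^ 2 * huu +
      Mr ^ 2 * hvv - Tr ^ 2 * (v * v' * huu + hvv)
  rw [hdet, mul_eq_zero, Complex.ofReal_eq_zero]
  simp
end
end

section
/- For τ ∈ ℝ and ω ∈ (0, π) define F(λ) := (4 − τ²)² − (4 + τ²)²·cos(2πλ) − 16τ²·cos(2πλ − 4ωλ − 2ω). Assume τ ∉ {−2, 0, 2}. If ω ≠ π/2, then there exists exactly one λ₁ ∈ (−1, −1/2) with F(λ₁) = 0, there exists exactly one λ₂ ∈ (−1/2, 0) with F(λ₂) = 0, and F(−1/2) ≠ 0. If ω = π/2, then F(λ) ≠ 0 for all λ ∈ (−1, 0). -/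
noncomputable section

open Set in
/-- If `B = A + C` with `B, C > 0` and `0 < b < 2π`, then `A + B cos (2πx) + C cos (bx)` has exactly
one zero in `(0, 1/2)`: it decreases strictly from `2B` to `C (cos (b/2) - 1) < 0`. -/
theorem existsUnique_zero_add_cos_add_cos {A B C b : ℝ} (hB : 0 < B) (hC : 0 < C)
    (hABC : B = A + C) (hb : 0 < b) (hb' : b < 2 * Real.pi) :
    ∃! x, x ∈ Ioo (0 : ℝ) (1 / 2) ∧
      A + B * Real.cos (2 * Real.pi * x) + C * Real.cos (b * x) = 0 := by
  have hpi := Real.pi_pos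
  have hanti : StrictAntiOn
      (fun x : ℝ => A + B * Real.cos (2 * Real.pi * x) + C * Real.cos (b * x))
      (Icc 0 (1 / 2)) := by
    rintro x ⟨hx0, hx1⟩ y ⟨hy0, hy1⟩ hxy
    have h₁ : Real.cos (2 * Real.pi * y) < Real.cos (2 * Real.pi * x) :=
      Real.cos_lt_cos_of_nonneg_of_le_pi (by positivity) (by nlinarith) (by gcongr)
    have h₂ : Real.cos (b * y) < Real.cos (b * x) :=
      Real.cos_lt_cos_of_nonneg_of_le_pi (by positivity) (by nlinarith) (by gcongr)
    dsimp only
    gcongr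
  have hcont : ContinuousOn
      (fun x : ℝ => A + B * Real.cos (2 * Real.pi * x) + C * Real.cos (b * x))
      (Icc 0 (1 / 2)) := by fun_prop
  have hend : Real.cos (b * (1 / 2)) < 1 := by
    simpa using Real.cos_lt_cos_of_nonneg_of_le_pi le_rfl
      (by linarith : b * (1 / 2) ≤ Real.pi) (by linarith)
  have hmid : Real.cos (2 * Real.pi * (1 / 2)) = -1 := by
    rw [show 2 * Real.pi * (1 / 2) = Real.pi by ring, Real.cos_pi]
  obtain ⟨x, hx, hx0⟩ := intermediate_value_Ioo' (by norm_num : (0 : ℝ) ≤ 1 / 2) hcont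
    (show (0 : ℝ) ∈ Ioo _ _ from
      ⟨by rw [hmid]; nlinarith, by simp only [mul_zero, Real.cos_zero]; linarith⟩)
  refine ⟨x, ⟨hx, hx0⟩, fun y hy => ?_⟩
  exact hanti.injOn (Ioo_subset_Icc_self hy.1) (Ioo_subset_Icc_self hx) (hy.2.trans hx0.symm)

/-- roots in `(−1, 0)` of the eigenvalue equation for the spin-orbit
operator of the broken line with equal interaction strengths on both edges. -/
theorem equal_strengths_roots
    (τ ω : ℝ) (hω : ω ∈ Set.Ioo 0 Real.pi)
    (hτ : τ ≠ -2) (hτ0 : τ ≠ 0) (hτ' : τ ≠ 2) :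
    let F : ℝ → ℝ := fun lam =>
      (4 - τ ^ 2) ^ 2 - (4 + τ ^ 2) ^ 2 * Real.cos (2 * Real.pi * lam)
        - 16 * τ ^ 2 * Real.cos (2 * Real.pi * lam - 4 * ω * lam - 2 * ω)
    (ω ≠ Real.pi / 2 →
      (∃! lam, lam ∈ Set.Ioo (-1 : ℝ) (-1/2) ∧ F lam = 0) ∧
      (∃! lam, lam ∈ Set.Ioo (-1/2 : ℝ) 0 ∧ F lam = 0) ∧
      F (-1/2) ≠ 0) ∧
    (ω = Real.pi / 2 → ∀ lam ∈ Set.Ioo (-1 : ℝ) 0, F lam ≠ 0) := by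
  intro F
  obtain ⟨hω0, hωpi⟩ := hω
  have hB : 0 < (4 + τ ^ 2) ^ 2 := by positivity
  have hC : 0 < 16 * τ ^ 2 := by positivity
  have hABC : (4 + τ ^ 2) ^ 2 = (4 - τ ^ 2) ^ 2 + 16 * τ ^ 2 := by ring
  have hF : ∀ x, F (-1/2 + x) = (4 - τ ^ 2) ^ 2 + (4 + τ ^ 2) ^ 2 * Real.cos (2 * Real.pi * x)
      + 16 * τ ^ 2 * Real.cos (|2 * Real.pi - 4 * ω| * x) := by
    intro x
    have h₁ : Real.cos (2 * Real.pi * (-1/2 + x)) = -Real.cos (2 * Real.pi * x) := by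
      rw [← Real.cos_sub_pi]; ring_nf
    have h₂ : Real.cos (2 * Real.pi * (-1/2 + x) - 4 * ω * (-1/2 + x) - 2 * ω)
        = -Real.cos (|2 * Real.pi - 4 * ω| * x) := by
      have habs : Real.cos (|2 * Real.pi - 4 * ω| * x) = Real.cos ((2 * Real.pi - 4 * ω) * x) := by
        rw [← Real.cos_abs, abs_mul, abs_abs, ← abs_mul, Real.cos_abs]
      rw [habs, ← Real.cos_sub_pi]; ring_nf
    simp only [F, h₁, h₂]; ring
  have hF_neg : ∀ x, F (-1/2 + -x) = F (-1/2 + x) := by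
    intro x
    simp only [hF, mul_neg, Real.cos_neg]
  refine ⟨fun hne => ?_, ?_⟩
  · have hb : 0 < |2 * Real.pi - 4 * ω| :=
      abs_pos.2 fun h => hne (by linarith)
    have hb' : |2 * Real.pi - 4 * ω| < 2 * Real.pi :=
      abs_lt.2 ⟨by linarith, by linarith⟩
    obtain ⟨x, ⟨⟨hx0, hx1⟩, hx⟩, huniq⟩ :=
      existsUnique_zero_add_cos_add_cos hB hC hABC hb hb'
    rw [← hF] at hx
    simp only [← hF] at huniq
    refine ⟨⟨-1/2 + -x, ⟨⟨by linarith, by linarith⟩, (hF_neg x).trans hx⟩, ?_⟩,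
      ⟨-1/2 + x, ⟨⟨by linarith, by linarith⟩, hx⟩, ?_⟩, ?_⟩
    · rintro y ⟨⟨hy0, hy1⟩, hy⟩
      have := huniq (-(y + 1/2)) ⟨⟨by linarith, by linarith⟩, by
        rw [hF_neg, ← hy]; ring_nf⟩
      linarith
    · rintro y ⟨⟨hy0, hy1⟩, hy⟩
      have := huniq (y + 1/2) ⟨⟨by linarith, by linarith⟩, by
        rw [← hy]; ring_nf⟩
      linarith
    · have h := hF 0
      simp only [add_zero, mul_zero, Real.cos_zero, mul_one] at h
      rw [h]
      positivity
  · rintro rfl lam ⟨h0, h1⟩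
    have hpi := Real.pi_pos
    have hcos : Real.cos (2 * Real.pi * lam) < 1 := by
      refine lt_of_le_of_ne (Real.cos_le_one _) fun h => ?_
      rw [Real.cos_eq_one_iff_of_lt_of_lt (by nlinarith) (by nlinarith)] at h
      exact h1.ne (by simpa [hpi.ne'] using h)
    have hphase : 2 * Real.pi * lam - 4 * (Real.pi / 2) * lam - 2 * (Real.pi / 2) = -Real.pi := by
      ring
    simp only [F, hphase, Real.cos_neg, Real.cos_pi]
    nlinarith
end
end

section
/- For τ ∈ ℝ and ω ∈ (0, π) define G(λ) := (4 − τ²)² − (4 + τ²)²·cos(2πλ) + 16τ²·cos(2πλ − 4ωλ − 2ω). Assume τ ∉ {−2, 0, 2}. Then there exists exactly one λ₁ ∈ (−1, −1/2) with G(λ₁) = 0, there exists exactly one λ₂ ∈ (−1/2, 0) with G(λ₂) = 0, and G(−1/2) ≠ 0. -/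
noncomputable section

/-- For `0 ≤ β < π` the ratio `cos (π x) / cos (β x)` is strictly decreasing on `(0, 1/2)`. -/
lemma strictAntiOn_cos_pi_mul_div_cos_mul {β : ℝ} (hβ : 0 ≤ β) (hβπ : β < Real.pi) :
    StrictAntiOn (fun x => Real.cos (Real.pi * x) / Real.cos (β * x))
      (Set.Ioo (0 : ℝ) (1 / 2)) := by
  have hcos : ∀ x ∈ Set.Ioo (0 : ℝ) (1 / 2), 0 < Real.cos (β * x) := fun x hx =>
    Real.cos_pos_of_mem_Ioo ⟨by nlinarith [hx.1, hx.2, Real.pi_pos], by nlinarith [hx.1, hx.2]⟩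
  have hd : ∀ x ∈ Set.Ioo (0 : ℝ) (1 / 2),
      HasDerivAt (fun x => Real.cos (Real.pi * x) / Real.cos (β * x))
        ((-Real.sin (Real.pi * x) * Real.pi * Real.cos (β * x)
          - Real.cos (Real.pi * x) * (-Real.sin (β * x) * β)) / Real.cos (β * x) ^ 2) x := by
    intro x hx
    have hlin : ∀ c : ℝ, HasDerivAt (fun x : ℝ => c * x) c x := fun c => by
      simpa using (hasDerivAt_id x).const_mul c
    exact (hlin Real.pi).cos.div (hlin β).cos (hcos x hx).ne'
  refine strictAntiOn_of_deriv_neg (convex_Ioo _ _)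
    (fun x hx => (hd x hx).continuousAt.continuousWithinAt) fun x hx => ?_
  rw [interior_Ioo] at hx
  rw [(hd x hx).deriv]
  refine div_neg_of_neg_of_pos ?_ (pow_pos (hcos x hx) 2)
  obtain ⟨hx0, hx1⟩ := hx
  have hsub : 0 < Real.sin (Real.pi * x - β * x) :=
    Real.sin_pos_of_pos_of_lt_pi (by nlinarith) (by nlinarith [Real.pi_pos])
  rw [Real.sin_sub] at hsub
  have hs : 0 ≤ Real.sin (β * x) :=
    Real.sin_nonneg_of_nonneg_of_le_pi (by positivity) (by nlinarith [Real.pi_pos])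
  have hc : 0 ≤ Real.cos (Real.pi * x) :=
    Real.cos_nonneg_of_mem_Icc ⟨by nlinarith [Real.pi_pos], by nlinarith [Real.pi_pos]⟩
  nlinarith [mul_pos Real.pi_pos hsub, mul_nonneg (mul_nonneg hc hs) (sub_nonneg.2 hβπ.le)]

lemma existsUnique_mul_cos_pi_mul_eq {a b β : ℝ} (hb : 0 < b) (hba : b < a)
    (hβ : 0 ≤ β) (hβπ : β < Real.pi) :
    ∃! x, x ∈ Set.Ioo (0 : ℝ) (1 / 2) ∧ a * Real.cos (Real.pi * x) = b * Real.cos (β * x) := by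
  have hcos : ∀ x ∈ Set.Ioc (0 : ℝ) (1 / 2), 0 < Real.cos (β * x) := fun x hx =>
    Real.cos_pos_of_mem_Ioo ⟨by nlinarith [hx.1, hx.2, Real.pi_pos], by nlinarith [hx.1, hx.2]⟩
  have hcont : ContinuousOn (fun x => a * Real.cos (Real.pi * x) - b * Real.cos (β * x))
      (Set.Icc (0 : ℝ) (1 / 2)) := by fun_prop
  have hmem : (0 : ℝ) ∈ Set.Ioo (a * Real.cos (Real.pi * (1 / 2)) - b * Real.cos (β * (1 / 2)))
      (a * Real.cos (Real.pi * 0) - b * Real.cos (β * 0)) := by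
    rw [mul_one_div, Real.cos_pi_div_two]
    have := mul_pos hb (hcos (1 / 2) ⟨by norm_num, le_rfl⟩)
    constructor
    · linarith
    · simpa using hba
  obtain ⟨x, hx, hx0⟩ := intermediate_value_Ioo' (by norm_num) hcont hmem
  refine ⟨x, ⟨hx, sub_eq_zero.1 hx0⟩, ?_⟩
  have hratio : ∀ y ∈ Set.Ioo (0 : ℝ) (1 / 2),
      a * Real.cos (Real.pi * y) = b * Real.cos (β * y) →
      Real.cos (Real.pi * y) / Real.cos (β * y) = b / a := fun y hy h => by
    rw [div_eq_div_iff (hcos y ⟨hy.1, hy.2.le⟩).ne' (hb.trans hba).ne', ← h, mul_comm]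
  rintro y ⟨hy, hy0⟩
  exact (strictAntiOn_cos_pi_mul_div_cos_mul hβ hβπ).injOn hy hx
    ((hratio y hy hy0).trans (hratio x hx (sub_eq_zero.1 hx0)).symm)

/-- roots in `(−1, 0)` of the eigenvalue equation for the spin-orbit
operator of the broken line with interaction strengths of opposite signs on the
two edges. -/
theorem opposite_strengths_roots
    (τ ω : ℝ) (hω : ω ∈ Set.Ioo 0 Real.pi)
    (hτ : τ ≠ -2) (hτ0 : τ ≠ 0) (hτ' : τ ≠ 2) :
    let G : ℝ → ℝ := fun lam =>
      (4 - τ ^ 2) ^ 2 - (4 + τ ^ 2) ^ 2 * Real.cos (2 * Real.pi * lam)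
        + 16 * τ ^ 2 * Real.cos (2 * Real.pi * lam - 4 * ω * lam - 2 * ω)
    (∃! lam, lam ∈ Set.Ioo (-1 : ℝ) (-1/2) ∧ G lam = 0) ∧
    (∃! lam, lam ∈ Set.Ioo (-1/2 : ℝ) 0 ∧ G lam = 0) ∧
    G (-1/2) ≠ 0 := by
  intro G
  obtain ⟨hω0, hωπ⟩ := hω
  set β := |Real.pi - 2 * ω| with hβdef
  have hβ : 0 ≤ β := abs_nonneg _
  have hβπ : β < Real.pi := abs_lt.2 ⟨by linarith, by linarith⟩
  have hb : 0 < 4 * |τ| := by positivity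
  have hne : |τ| ≠ 2 := fun h => by
    rcases (abs_eq (by norm_num)).1 h with h | h
    exacts [hτ' h, hτ h]
  have hba : 4 * |τ| < 4 + τ ^ 2 := by
    nlinarith [sq_abs τ, sq_pos_of_ne_zero (sub_ne_zero.2 hne)]
  -- shifted by `1/2`, `G` is an even difference of two squares
  have hG : ∀ x, G (x - 1 / 2) = 2 * (((4 + τ ^ 2) * Real.cos (Real.pi * x)) ^ 2
      - (4 * |τ| * Real.cos (β * x)) ^ 2) := by
    intro x
    have hcosβ : Real.cos (β * x) = Real.cos ((Real.pi - 2 * ω) * x) := by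
      rcases abs_choice (Real.pi - 2 * ω) with h | h
      · rw [hβdef, h]
      · rw [hβdef, h, neg_mul, Real.cos_neg]
    have h₁ : 2 * Real.pi * (x - 1 / 2) = 2 * (Real.pi * x) - Real.pi := by ring
    have h₂ : 2 * (Real.pi * x) - Real.pi - 4 * ω * (x - 1 / 2) - 2 * ω
        = 2 * ((Real.pi - 2 * ω) * x) - Real.pi := by ring
    simp only [G]
    rw [h₁, h₂, Real.cos_sub_pi, Real.cos_sub_pi, Real.cos_two_mul, Real.cos_two_mul, hcosβ,
      mul_pow (4 * |τ|), mul_pow 4, sq_abs]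
    ring
  have hGneg : ∀ x, G (-x - 1 / 2) = G (x - 1 / 2) := fun x => by
    rw [hG, hG, mul_neg, mul_neg, Real.cos_neg, Real.cos_neg]
  have hiff : ∀ x ∈ Set.Ioo (0 : ℝ) (1 / 2), G (x - 1 / 2) = 0 ↔
      (4 + τ ^ 2) * Real.cos (Real.pi * x) = 4 * |τ| * Real.cos (β * x) := by
    rintro x ⟨hx0, hx1⟩
    have hc₁ : 0 ≤ Real.cos (Real.pi * x) :=
      Real.cos_nonneg_of_mem_Icc ⟨by nlinarith [Real.pi_pos], by nlinarith [Real.pi_pos]⟩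
    have hc₂ : 0 ≤ Real.cos (β * x) :=
      Real.cos_nonneg_of_mem_Icc ⟨by nlinarith [Real.pi_pos], by nlinarith⟩
    rw [hG, mul_eq_zero_iff_left two_ne_zero, sub_eq_zero,
      sq_eq_sq₀ (by positivity) (by positivity)]
  obtain ⟨x, ⟨hx, hx0⟩, huniq⟩ := existsUnique_mul_cos_pi_mul_eq hb hba hβ hβπ
  have hGx : G (x - 1 / 2) = 0 := (hiff x hx).2 hx0
  refine ⟨⟨-x - 1 / 2, ⟨⟨by linarith [hx.2], by linarith [hx.1]⟩, by rw [hGneg, hGx]⟩, ?_⟩,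
    ⟨x - 1 / 2, ⟨⟨by linarith [hx.1], by linarith [hx.2]⟩, hGx⟩, ?_⟩, ?_⟩
  · rintro y ⟨⟨hy0, hy1⟩, hy⟩
    have hmem : -y - 1 / 2 ∈ Set.Ioo (0 : ℝ) (1 / 2) := ⟨by linarith, by linarith⟩
    have hval : G (-y - 1 / 2 - 1 / 2) = 0 := by
      rw [← hGneg, ← hy]
      congr 1
      ring
    linarith [huniq _ ⟨hmem, (hiff _ hmem).1 hval⟩]
  · rintro y ⟨⟨hy0, hy1⟩, hy⟩
    have hmem : y + 1 / 2 ∈ Set.Ioo (0 : ℝ) (1 / 2) := ⟨by linarith, by linarith⟩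
    have hval : G (y + 1 / 2 - 1 / 2) = 0 := by rwa [add_sub_cancel_right]
    linarith [huniq _ ⟨hmem, (hiff _ hmem).1 hval⟩]
  · have h := hG 0
    rw [mul_zero, mul_zero, Real.cos_zero, mul_one, mul_one] at h
    rw [show (-1 / 2 : ℝ) = 0 - 1 / 2 by norm_num, h]
    have := pow_lt_pow_left₀ hba hb.le two_ne_zero
    linarith
end
end

section
/- Let τ_l, τ_r ∈ ℝ with τ_l ≠ ±2 and τ_r ≠ ±2, let ω ∈ ℝ and λ ∈ ℝ. Then (c₊₁, c₊₂, c₋₁, c₋₂) ∈ ℂ⁴ is a solution of the broken-line eigenvalue system with parameters (τ_l, τ_r, ω, λ) if and only if (c₊₂, c₊₁, c₋₂, c₋₁) is a solution of the broken-line eigenvalue system with parameters (τ_l, τ_r, ω, −1−λ). In particular, the swap map (c₊₁, c₊₂, c₋₁, c₋₂) ↦ (c₊₂, c₊₁, c₋₂, c₋₁) is a linear bijection between the two solution spaces, which therefore have equal dimension. -/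
noncomputable section

/-- Swapping the components turns a solution for `lam` into a solution for `-1 - lam`. -/
theorem BrokenLineSystem.swap {τl τr ω lam : ℝ} {cp1 cp2 cm1 cm2 : ℂ}
    (h : BrokenLineSystem τl τr ω lam cp1 cp2 cm1 cm2) :
    BrokenLineSystem τl τr ω (-1 - lam) cp2 cp1 cm2 cm1 := by
  obtain ⟨h₁, h₂, h₃, h₄⟩ := h
  have angle : ω * (2 * (-1 - lam) + 1) = -(ω * (2 * lam + 1)) := by ring
  have phase_neg : Complex.exp (-(2 * (Real.pi : ℂ) * Complex.I * ((-1 - lam : ℝ) : ℂ))) =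
      Complex.exp (2 * (Real.pi : ℂ) * Complex.I * (lam : ℂ)) := by
    rw [← Complex.exp_periodic (2 * (Real.pi : ℂ) * Complex.I * (lam : ℂ))]
    congr 1
    push_cast
    ring
  have phase : Complex.exp (2 * (Real.pi : ℂ) * Complex.I * ((-1 - lam : ℝ) : ℂ)) =
      Complex.exp (-(2 * (Real.pi : ℂ) * Complex.I * (lam : ℂ))) := by
    rw [← neg_neg (2 * (Real.pi : ℂ) * Complex.I * ((-1 - lam : ℝ) : ℂ)), Complex.exp_neg,
      phase_neg, Complex.exp_neg]
  have mixed : Complex.exp (Complex.I *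
        ((ω * (2 * (-1 - lam) + 1) - 2 * Real.pi * (-1 - lam) : ℝ) : ℂ)) =
      Complex.exp (-(Complex.I * ((ω * (2 * lam + 1) - 2 * Real.pi * lam : ℝ) : ℂ))) := by
    rw [← Complex.exp_periodic (-(Complex.I * _))]
    congr 1
    push_cast
    ring
  have mixed_neg : Complex.exp (-(Complex.I *
        ((ω * (2 * (-1 - lam) + 1) - 2 * Real.pi * (-1 - lam) : ℝ) : ℂ))) =
      Complex.exp (Complex.I * ((ω * (2 * lam + 1) - 2 * Real.pi * lam : ℝ) : ℂ)) := by
    rw [Complex.exp_neg, mixed, Complex.exp_neg, inv_inv]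
  unfold BrokenLineSystem
  rw [phase_neg, phase, mixed, mixed_neg, angle, Complex.ofReal_neg, mul_neg, neg_neg]
  refine ⟨?_, ?_, ?_, ?_⟩
  · rw [h₂]; ring
  · rw [h₁]; ring
  · rw [h₄]; ring
  · rw [h₃]; ring

/-- The swap is an equivalence, since `lam ↦ -1 - lam` is an involution. -/
theorem brokenLineSystem_iff_swap (τl τr ω lam : ℝ) (cp1 cp2 cm1 cm2 : ℂ) :
    BrokenLineSystem τl τr ω lam cp1 cp2 cm1 cm2 ↔
      BrokenLineSystem τl τr ω (-1 - lam) cp2 cp1 cm2 cm1 :=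
  ⟨BrokenLineSystem.swap, fun h => by simpa using h.swap⟩

/-- `(cp1, cp2, cm1, cm2)` solves the broken-line eigenvalue system
for the spectral parameter `λ` iff the swapped tuple `(cp2, cp1, cm2, cm1)`
solves it for `−1 − λ`; in particular the swap map is a bijection between the
two solution spaces. -/
theorem brokenLineSystem_swap_symmetry
    (τl τr ω lam : ℝ) (hl : τl ≠ 2) (hl' : τl ≠ -2) (hr : τr ≠ 2) (hr' : τr ≠ -2) :
    (∀ cp1 cp2 cm1 cm2 : ℂ,
      BrokenLineSystem τl τr ω lam cp1 cp2 cm1 cm2 ↔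
        BrokenLineSystem τl τr ω (-1 - lam) cp2 cp1 cm2 cm1) ∧
    Set.BijOn (fun c : ℂ × ℂ × ℂ × ℂ => (c.2.1, c.1, c.2.2.2, c.2.2.1))
      {c : ℂ × ℂ × ℂ × ℂ | BrokenLineSystem τl τr ω lam c.1 c.2.1 c.2.2.1 c.2.2.2}
      {c : ℂ × ℂ × ℂ × ℂ | BrokenLineSystem τl τr ω (-1 - lam) c.1 c.2.1 c.2.2.1 c.2.2.2} := by
  refine ⟨brokenLineSystem_iff_swap τl τr ω lam, fun c hc => hc.swap, ?_, ?_⟩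
  · rintro ⟨a, b, c, d⟩ - ⟨a', b', c', d'⟩ - h
    simp_all
  · rintro ⟨a, b, c, d⟩ h
    exact ⟨(b, a, d, c), (brokenLineSystem_iff_swap τl τr ω lam b a d c).2 h, rfl⟩
end
end

section
/- Let τ_l, τ_r ∈ ℝ \ {−2, 0, 2} and ω ∈ (0, π), and assume τ_l ≠ τ_r, τ_l ≠ −τ_r, τ_l·τ_r ≠ 4 and τ_l·τ_r ≠ −4. Then for every λ ∈ ℝ, the solution space in ℂ⁴ of the broken-line eigenvalue system with parameters (τ_l, τ_r, ω, λ) has dimension at most 1. -/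
noncomputable section

/-- Under the non-resonance conditions, `m(τl)/p(τl)` and `m(τr)/p(τr)` have distinct
absolute values. -/
theorem abs_brokenM_div_brokenP_ne {τl τr : ℝ}
    (hl : τl ≠ 2) (hl' : τl ≠ -2) (hr : τr ≠ 2) (hr' : τr ≠ -2)
    (hne : τl ≠ τr) (hne' : τl ≠ -τr) (hp : τl * τr ≠ 4) (hp' : τl * τr ≠ -4) :
    |brokenM τl / brokenP τl| ≠ |brokenM τr / brokenP τr| := by
  have brokenP_ne_zero : ∀ {τ : ℝ}, τ ≠ 2 → τ ≠ -2 → brokenP τ ≠ 0 := by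
    intro τ h h' h0
    have : (τ - 2) * (τ + 2) = 0 := by unfold brokenP at h0; linarith
    rcases mul_eq_zero.mp this with h1 | h1
    · exact h (by linarith)
    · exact h' (by linarith)
  have hPl := brokenP_ne_zero hl hl'
  have hPr := brokenP_ne_zero hr hr'
  intro h
  rcases abs_eq_abs.mp h with h | h
  · rw [div_eq_div_iff hPl hPr] at h
    have : (τl - τr) * (τl + τr) = 0 := by unfold brokenM brokenP at h; linarith
    rcases mul_eq_zero.mp this with h1 | h1
    · exact hne (by linarith)
    · exact hne' (by linarith)
  · rw [← neg_div, div_eq_div_iff hPl hPr] at h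
    have : (τl * τr - 4) * (τl * τr + 4) = 0 := by unfold brokenM brokenP at h; linarith
    rcases mul_eq_zero.mp this with h1 | h1
    · exact hp (by linarith)
    · exact hp' (by linarith)

/-- if neither `τl = ±τr` nor `τl·τr = ±4`, then for each spectral
parameter `λ` the solution space of the broken-line eigenvalue system has
dimension at most one, i.e. any two solutions are linearly dependent. -/
theorem brokenLineSystem_simple_spectrum
    (τl τr ω : ℝ)
    (hl : τl ≠ 2) (hl' : τl ≠ -2) (hl0 : τl ≠ 0)
    (hr : τr ≠ 2) (hr' : τr ≠ -2) (hr0 : τr ≠ 0)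
    (hω : ω ∈ Set.Ioo 0 Real.pi)
    (hne : τl ≠ τr) (hne' : τl ≠ -τr) (hp : τl * τr ≠ 4) (hp' : τl * τr ≠ -4)
    (lam : ℝ) :
    ∀ c d : ℂ × ℂ × ℂ × ℂ,
      BrokenLineSystem τl τr ω lam c.1 c.2.1 c.2.2.1 c.2.2.2 →
      BrokenLineSystem τl τr ω lam d.1 d.2.1 d.2.2.1 d.2.2.2 →
      ∃ a b : ℂ, ¬(a = 0 ∧ b = 0) ∧ a • c = b • d := by
  intro c d hc hd
  obtain ⟨c1, c2, c3, c4⟩ := c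
  obtain ⟨d1, d2, d3, d4⟩ := d
  obtain ⟨hc1, hc2, hc3, -⟩ := hc
  obtain ⟨hd1, hd2, hd3, -⟩ := hd
  dsimp only at hc1 hc2 hc3 hd1 hd2 hd3
  -- the coefficient of `c₊₁` in the difference of the two equations for `c₋₁` is nonzero
  have hA : ((brokenM τl / brokenP τl : ℝ) : ℂ) ≠ ((brokenM τr / brokenP τr : ℝ) : ℂ) *
      Complex.exp (-(2 * (Real.pi : ℂ) * Complex.I * (lam : ℂ))) := by
    intro h
    apply abs_brokenM_div_brokenP_ne hl hl' hr hr' hne hne' hp hp'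
    have h2 := congrArg norm h
    rw [norm_mul, Complex.norm_real, Complex.norm_real, Complex.norm_exp] at h2
    simpa [abs_div] using h2
  generalize ((brokenM τl / brokenP τl : ℝ) : ℂ) = ml at *
  generalize ((brokenM τr / brokenP τr : ℝ) : ℂ) *
      Complex.exp (-(2 * (Real.pi : ℂ) * Complex.I * (lam : ℂ))) = mr at *
  have hA' : ml - mr ≠ 0 := sub_ne_zero.mpr hA
  have hdet : d2 * c1 = c2 * d1 := by
    apply mul_left_cancel₀ hA'
    linear_combination d2 * (hc3 - hc1) - c2 * (hd3 - hd1)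
  by_cases h0 : d2 = 0 ∧ c2 = 0
  · obtain ⟨rfl, rfl⟩ := h0
    have hc0 : c1 = 0 := by
      apply mul_left_cancel₀ hA'
      linear_combination hc3 - hc1
    have hd0 : d1 = 0 := by
      apply mul_left_cancel₀ hA'
      linear_combination hd3 - hd1
    exact ⟨1, 1, by simp, by simp [hc1, hc2, hd1, hd2, hc0, hd0]⟩
  · refine ⟨d2, c2, h0, ?_⟩
    simp only [Prod.smul_mk, smul_eq_mul, Prod.mk.injEq]
    refine ⟨hdet, mul_comm _ _, ?_, ?_⟩
    · linear_combination d2 * hc1 - c2 * hd1 + ml * hdet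
    · rw [hc2, hd2]
      linear_combination ((τl / brokenP τl : ℝ) : ℂ) *
          Complex.exp (Complex.I * ((ω * (2 * lam + 1) : ℝ) : ℂ)) * hdet
end
end

section
/- Let τ_l, τ_r ∈ ℝ with τ_l ≠ ±2 and τ_r ≠ ±2, and let ω ∈ (0, π). Then λ = −1/2 satisfies the broken-line eigenvalue equation 1 − (m(τ_l)·m(τ_r)/(p(τ_l)·p(τ_r)))·cos(2πλ) − (τ_l·τ_r/(p(τ_l)·p(τ_r)))·cos(2ω(2λ+1) − 2πλ) = 0 if and only if τ_l·τ_r = −4. (Indeed, substituting λ = −1/2 and clearing denominators turns the left-hand side into a nonzero multiple of (4 + τ_l·τ_r)².) -/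
noncomputable section

/-- `λ = −1/2` satisfies the broken-line eigenvalue equation if
and only if `τl·τr = −4`. -/
theorem brokenLine_eigenvalue_at_neg_half_iff
    (τl τr ω : ℝ) (hl : τl ≠ 2) (hl' : τl ≠ -2) (hr : τr ≠ 2) (hr' : τr ≠ -2)
    (hω : ω ∈ Set.Ioo 0 Real.pi) :
    (1 - brokenM τl * brokenM τr / (brokenP τl * brokenP τr)
          * Real.cos (2 * Real.pi * (-1/2 : ℝ))
      - τl * τr / (brokenP τl * brokenP τr) *
          Real.cos (2 * ω * (2 * (-1/2 : ℝ) + 1) - 2 * Real.pi * (-1/2 : ℝ)) = 0) ↔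
    τl * τr = -4 := by
  have hcos : Real.cos (2 * Real.pi * (-1/2 : ℝ)) = -1 := by
    rw [show 2 * Real.pi * (-1/2 : ℝ) = -Real.pi by ring, Real.cos_neg, Real.cos_pi]
  have hcos' : Real.cos (2 * ω * (2 * (-1/2 : ℝ) + 1) - 2 * Real.pi * (-1/2 : ℝ)) = -1 := by
    rw [show 2 * ω * (2 * (-1/2 : ℝ) + 1) - 2 * Real.pi * (-1/2 : ℝ) = Real.pi by ring,
      Real.cos_pi]
  have hpl := brokenP_ne_zero hl hl'
  have hpr := brokenP_ne_zero hr hr'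
  have hsq : 1 - brokenM τl * brokenM τr / (brokenP τl * brokenP τr) * (-1)
      - τl * τr / (brokenP τl * brokenP τr) * (-1)
      = (τl * τr + 4) ^ 2 / (8 * (brokenP τl * brokenP τr)) := by
    field_simp
    unfold brokenP brokenM
    ring
  rw [hcos, hcos', hsq, div_eq_zero_iff, or_iff_left (by positivity), sq_eq_zero_iff,
    add_eq_zero_iff_eq_neg]
end
end

section
/- Let τ_l, τ_r ∈ ℝ with τ_l ≠ ±2 and τ_r ≠ ±2, let ω ∈ (0, π), and assume τ_l·τ_r = −4. Then the solution space in ℂ⁴ of the broken-line eigenvalue system with parameters (τ_l, τ_r, ω, λ) at λ = −1/2 has dimension exactly 2; concretely, for every (c₊₁, c₊₂) ∈ ℂ² there is exactly one pair (c₋₁, c₋₂) ∈ ℂ² such that (c₊₁, c₊₂, c₋₁, c₋₂) solves the system. -/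
noncomputable section

theorem brokenP_neg_four_div {τ : ℝ} (hτ : τ ≠ 0) :
    brokenP (-4 / τ) = -(4 / τ ^ 2) * brokenP τ := by
  unfold brokenP
  field_simp
  ring

theorem brokenM_neg_four_div {τ : ℝ} (hτ : τ ≠ 0) :
    brokenM (-4 / τ) = 4 / τ ^ 2 * brokenM τ := by
  unfold brokenM
  field_simp
  ring

theorem brokenM_div_brokenP_neg_four_div {τ : ℝ} (hτ : τ ≠ 0) :
    brokenM (-4 / τ) / brokenP (-4 / τ) = -(brokenM τ / brokenP τ) := by
  rw [brokenP_neg_four_div hτ, brokenM_neg_four_div hτ, neg_mul, div_neg,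
    mul_div_mul_left _ _ (by positivity)]

theorem neg_four_div_div_brokenP {τ : ℝ} (hτ : τ ≠ 0) :
    -4 / τ / brokenP (-4 / τ) = τ / brokenP τ := by
  rw [brokenP_neg_four_div hτ, show -4 / τ = -(4 / τ ^ 2) * τ by field_simp,
    mul_div_mul_left _ _ (neg_ne_zero.2 (by positivity))]

/-- At `λ = -1/2` all the phases are `±1`. -/
theorem brokenLineSystem_neg_half_iff (τl τr ω : ℝ) (cp1 cp2 cm1 cm2 : ℂ) :
    BrokenLineSystem τl τr ω (-1/2) cp1 cp2 cm1 cm2 ↔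
      cm1 = ((brokenM τl / brokenP τl : ℝ) : ℂ) * cp1 + ((τl / brokenP τl : ℝ) : ℂ) * cp2 ∧
      cm2 = ((τl / brokenP τl : ℝ) : ℂ) * cp1 + ((brokenM τl / brokenP τl : ℝ) : ℂ) * cp2 ∧
      cm1 = -((brokenM τr / brokenP τr : ℝ) : ℂ) * cp1 + ((τr / brokenP τr : ℝ) : ℂ) * cp2 ∧
      cm2 = ((τr / brokenP τr : ℝ) : ℂ) * cp1 - ((brokenM τr / brokenP τr : ℝ) : ℂ) * cp2 := by
  have hphase : ω * (2 * (-1/2) + 1) = 0 := by ring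
  have hphase' : (0 : ℝ) - 2 * Real.pi * (-1/2) = Real.pi := by ring
  have hpos : -(2 * (Real.pi : ℂ) * Complex.I * ((-1/2 : ℝ) : ℂ)) = Real.pi * Complex.I := by
    push_cast; ring
  have hneg : 2 * (Real.pi : ℂ) * Complex.I * ((-1/2 : ℝ) : ℂ) = -(Real.pi * Complex.I) := by
    push_cast; ring
  unfold BrokenLineSystem
  rw [hphase, hphase', hpos, hneg, mul_comm Complex.I (Real.pi : ℂ), Complex.exp_neg,
    Complex.exp_neg, Complex.exp_pi_mul_I]
  norm_num [sub_eq_add_neg]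

/-- if `τl·τr = −4`, then the solution space of the broken-line
eigenvalue system at `λ = −1/2` has dimension exactly two; concretely, every
`(cp1, cp2) ∈ ℂ²` extends in exactly one way to a solution
`(cp1, cp2, cm1, cm2)` of the system. -/
theorem brokenLineSystem_double_eigenvalue_at_zero
    (τl τr ω : ℝ) (hl : τl ≠ 2) (hl' : τl ≠ -2) (hr : τr ≠ 2) (hr' : τr ≠ -2)
    (hω : ω ∈ Set.Ioo 0 Real.pi) (hprod : τl * τr = -4) :
    ∀ cp1 cp2 : ℂ, ∃! cm : ℂ × ℂ,
      BrokenLineSystem τl τr ω (-1/2) cp1 cp2 cm.1 cm.2 := by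
  have hτ : τl ≠ 0 := by rintro rfl; norm_num at hprod
  obtain rfl : τr = -4 / τl := by rw [eq_div_iff hτ, mul_comm, hprod]
  intro cp1 cp2
  simp only [brokenLineSystem_neg_half_iff, brokenM_div_brokenP_neg_four_div hτ,
    neg_four_div_div_brokenP hτ]
  refine ⟨(((brokenM τl / brokenP τl : ℝ) : ℂ) * cp1 + ((τl / brokenP τl : ℝ) : ℂ) * cp2,
    ((τl / brokenP τl : ℝ) : ℂ) * cp1 + ((brokenM τl / brokenP τl : ℝ) : ℂ) * cp2),
    ⟨rfl, rfl, ?_, ?_⟩, fun cm h => Prod.ext h.1 h.2.1⟩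
  · push_cast; ring
  · push_cast; ring
end
end

section
/- For τ ∈ ℝ define H(λ) := (4 + τ²)³·cos(2πλ) − (4 − τ²)³ − 48·(4 + τ²)·τ²·cos((π/3)(2λ+1)). Assume τ ≠ ±2. If |τ| > 2√3, then there exists exactly one λ₁ ∈ (−1, −1/2) with H(λ₁) = 0 and exactly one λ₂ ∈ (−1/2, 0) with H(λ₂) = 0, and H(−1/2) ≠ 0. If |τ| ≤ 2√3, then H(λ) ≠ 0 for all λ ∈ (−1, 0). -/
noncomputable section

open Real in
/-- In terms of `c = cos (π / 3 * (2 * lam + 1))`, the eigenvalue equation is a cubic with a double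
root. -/
lemma three_edge_factorization (τ lam : ℝ) :
    (4 + τ ^ 2) ^ 3 * cos (2 * π * lam) - (4 - τ ^ 2) ^ 3
        - 48 * (4 + τ ^ 2) * τ ^ 2 * cos (π / 3 * (2 * lam + 1)) =
      -((4 + τ ^ 2) * cos (π / 3 * (2 * lam + 1)) + (4 - τ ^ 2)) *
        (2 * (4 + τ ^ 2) * cos (π / 3 * (2 * lam + 1)) - (4 - τ ^ 2)) ^ 2 := by
  have h : cos (2 * π * lam) = -cos (3 * (π / 3 * (2 * lam + 1))) := by
    rw [← cos_sub_pi]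
    congr 1
    ring
  rw [h, cos_three_mul]
  ring

open Real in
lemma half_lt_cos_of_mem_Ioo {lam : ℝ} (h : lam ∈ Set.Ioo (-1 : ℝ) 0) :
    1 / 2 < cos (π / 3 * (2 * lam + 1)) := by
  have hπ := pi_pos
  rw [← cos_pi_div_three, ← cos_abs (π / 3 * (2 * lam + 1))]
  apply cos_lt_cos_of_nonneg_of_le_pi (abs_nonneg _) (by linarith)
  rw [abs_lt]
  constructor <;> nlinarith [h.1, h.2]

open Real in
lemma three_edge_eq_zero_iff (τ : ℝ) {lam : ℝ} (h : lam ∈ Set.Ioo (-1 : ℝ) 0) :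
    (4 + τ ^ 2) ^ 3 * cos (2 * π * lam) - (4 - τ ^ 2) ^ 3
        - 48 * (4 + τ ^ 2) * τ ^ 2 * cos (π / 3 * (2 * lam + 1)) = 0 ↔
      cos (π / 3 * (2 * lam + 1)) = (τ ^ 2 - 4) / (τ ^ 2 + 4) := by
  have hc := half_lt_cos_of_mem_Ioo h
  have hτ := sq_nonneg τ
  rw [three_edge_factorization, eq_div_iff (by positivity), mul_eq_zero]
  constructor
  · rintro (h0 | h0)
    · linarith
    · have := pow_eq_zero_iff (two_ne_zero) |>.1 h0
      nlinarith
  · intro h0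
    left
    linarith

open Real in
/-- For `c` strictly between `1 / 2` and `1`, the equation `cos (π / 3 * (2 * lam + 1)) = c` has
exactly one solution in each half of `(-1, 0)`. -/
lemma existsUnique_cos_eq {c : ℝ} (hc : 1 / 2 < c) (hc' : c < 1) :
    (∃! lam, lam ∈ Set.Ioo (-1 : ℝ) (-1/2) ∧ cos (π / 3 * (2 * lam + 1)) = c) ∧
      ∃! lam, lam ∈ Set.Ioo (-1/2 : ℝ) 0 ∧ cos (π / 3 * (2 * lam + 1)) = c := by
  have hπ := pi_pos
  set s := arccos c / (π / 3) with hs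
  have hcos : cos (π / 3 * s) = c := by
    rw [hs, mul_div_cancel₀ _ (by positivity), cos_arccos (by linarith) hc'.le]
  have hs0 : 0 < s := div_pos (arccos_pos.2 hc') (by positivity)
  have hs1 : s < 1 := by
    rw [hs, div_lt_one (by positivity),
      ← arccos_cos (x := π / 3) (by positivity) (by linarith), cos_pi_div_three]
    exact arccos_lt_arccos (by norm_num) hc hc'.le
  have key : ∀ u : ℝ, 0 < u → u < 1 → cos (π / 3 * u) = c → u = s := by
    intro u hu hu' h
    have := injOn_cos (x₁ := π / 3 * u) (x₂ := π / 3 * s)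
      ⟨by positivity, by nlinarith⟩ ⟨by positivity, by nlinarith⟩ (h.trans hcos.symm)
    exact mul_left_cancel₀ (by positivity) this
  constructor
  · refine ⟨(-s - 1) / 2, ⟨⟨by linarith, by linarith⟩, ?_⟩, ?_⟩
    · rw [← hcos, ← cos_neg]
      congr 1
      ring
    · rintro y ⟨⟨h1, h2⟩, h⟩
      have := key (-(2 * y + 1)) (by linarith) (by linarith) (by rw [mul_neg, cos_neg, h])
      linarith
  · refine ⟨(s - 1) / 2, ⟨⟨by linarith, by linarith⟩, ?_⟩, ?_⟩
    · rw [← hcos]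
      congr 1
      ring
    · rintro y ⟨⟨h1, h2⟩, h⟩
      have := key (2 * y + 1) (by linarith) (by linarith) h
      linarith

/-- roots in `(−1, 0)` of the eigenvalue equation for the
spin-orbit operator of the symmetric star graph with three edges and equal
interaction strength `τ` on each edge. -/
theorem symmetric_three_edge_roots (τ : ℝ) (hτ : τ ≠ 2) (hτ' : τ ≠ -2) :
    let H : ℝ → ℝ := fun lam =>
      (4 + τ ^ 2) ^ 3 * Real.cos (2 * Real.pi * lam) - (4 - τ ^ 2) ^ 3
        - 48 * (4 + τ ^ 2) * τ ^ 2 * Real.cos (Real.pi / 3 * (2 * lam + 1))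
    (2 * Real.sqrt 3 < |τ| →
      (∃! lam, lam ∈ Set.Ioo (-1 : ℝ) (-1/2) ∧ H lam = 0) ∧
      (∃! lam, lam ∈ Set.Ioo (-1/2 : ℝ) 0 ∧ H lam = 0) ∧
      H (-1/2) ≠ 0) ∧
    (|τ| ≤ 2 * Real.sqrt 3 → ∀ lam ∈ Set.Ioo (-1 : ℝ) 0, H lam ≠ 0) := by
  intro H
  have hsqrt : (2 * Real.sqrt 3) ^ 2 = 12 := by
    rw [mul_pow, Real.sq_sqrt (by norm_num)]
    norm_num
  have hpos : 0 < τ ^ 2 + 4 := by positivity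
  have hlt1 : (τ ^ 2 - 4) / (τ ^ 2 + 4) < 1 := by
    rw [div_lt_one hpos]
    linarith
  have hH : ∀ lam ∈ Set.Ioo (-1 : ℝ) 0, H lam = 0 ↔
      Real.cos (Real.pi / 3 * (2 * lam + 1)) = (τ ^ 2 - 4) / (τ ^ 2 + 4) :=
    fun lam h => three_edge_eq_zero_iff τ h
  constructor
  · intro h
    have hsq : 12 < τ ^ 2 := by
      rw [← hsqrt, ← sq_abs τ]
      exact pow_lt_pow_left₀ h (by positivity) two_ne_zero
    have hhalf : 1 / 2 < (τ ^ 2 - 4) / (τ ^ 2 + 4) := by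
      rw [lt_div_iff₀ hpos]
      linarith
    obtain ⟨hleft, hright⟩ := existsUnique_cos_eq hhalf hlt1
    refine ⟨?_, ?_, ?_⟩
    · refine (existsUnique_congr fun lam => and_congr_right fun hl => ?_).2 hleft
      exact hH lam ⟨hl.1, by linarith [hl.2]⟩
    · refine (existsUnique_congr fun lam => and_congr_right fun hl => ?_).2 hright
      exact hH lam ⟨by linarith [hl.1], hl.2⟩
    · rw [Ne, hH _ ⟨by norm_num, by norm_num⟩]
      norm_num
      exact hlt1.ne'
  · intro h lam hl h0
    have hsq : τ ^ 2 ≤ 12 := by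
      rw [← hsqrt, ← sq_abs τ]
      exact pow_le_pow_left₀ (abs_nonneg τ) h 2
    have hc := half_lt_cos_of_mem_Ioo hl
    rw [(hH lam hl).1 h0, lt_div_iff₀ hpos] at hc
    linarith
end
end

section
/- Let τ ∈ ℝ with τ ∉ {2, −2, 2/√3, −2/√3}. Then λ ∈ ℝ satisfies (4 + τ²)³·cos(2πλ) − (4 − τ²)³ = 48·(4 + τ²)·τ²·cos((π/3)(2λ+1)) if and only if there exists k ∈ ℤ such that λ equals one of the following four numbers: 3k + (3/π)·arctan((6 − √3·τ)/(3τ + 2√3)); 3k + (3/π)·arctan((6 + √3·τ)/(2√3 − 3τ)); 3k − (3/π)·arctan((12 + 3τ² + √3·√(48 + 40τ² + 3τ⁴))/(8√3)); 3k + (3/π)·arctan((−12 − 3τ² + √3·√(48 + 40τ² + 3τ⁴))/(8√3)). -/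
noncomputable section

/-- The solutions of `tan (π l / 3) = x`, in a form free of division. -/
theorem exists_eq_add_arctan_iff (x l : ℝ) :
    (∃ k : ℤ, l = 3 * k + 3 / Real.pi * Real.arctan x) ↔
      Real.sin (Real.pi * l / 3) = x * Real.cos (Real.pi * l / 3) := by
  have hpi := Real.pi_ne_zero
  have hs : Real.sqrt (1 + x ^ 2) ≠ 0 := by positivity
  have key : Real.sin (Real.pi * l / 3 - Real.arctan x) = 0 ↔
      Real.sin (Real.pi * l / 3) = x * Real.cos (Real.pi * l / 3) := by
    rw [Real.sin_sub, Real.sin_arctan, Real.cos_arctan, ← sub_eq_zero (b := x * _)]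
    have : Real.sin (Real.pi * l / 3) * (1 / Real.sqrt (1 + x ^ 2)) -
        Real.cos (Real.pi * l / 3) * (x / Real.sqrt (1 + x ^ 2)) =
        (Real.sin (Real.pi * l / 3) - x * Real.cos (Real.pi * l / 3)) /
          Real.sqrt (1 + x ^ 2) := by ring
    rw [this, div_eq_zero_iff, or_iff_left hs]
  rw [← key, Real.sin_eq_zero_iff]
  refine exists_congr fun k => ⟨fun h => ?_, fun h => ?_⟩
  · rw [h]
    field_simp
    ring
  · have h' : Real.pi * l = 3 * (k * Real.pi + Real.arctan x) := by linarith
    field_simp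
    linarith

/-- With `θ = π l / 3`, the eigenvalue equation is a cubic in `cos (2 θ + π / 3)` which splits
into a linear factor and the square of another one. -/
theorem eigenvalue_equation_iff_factors (τ l : ℝ) :
    ((4 + τ ^ 2) ^ 3 * Real.cos (2 * Real.pi * l) - (4 - τ ^ 2) ^ 3 =
        48 * (4 + τ ^ 2) * τ ^ 2 * Real.cos (Real.pi / 3 * (2 * l + 1))) ↔
      (4 + τ ^ 2) * Real.cos (Real.pi / 3 * (2 * l + 1)) + (4 - τ ^ 2) = 0 ∨
      2 * (4 + τ ^ 2) * Real.cos (Real.pi / 3 * (2 * l + 1)) - (4 - τ ^ 2) = 0 := by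
  have h : Real.cos (2 * Real.pi * l) = -(4 * Real.cos (Real.pi / 3 * (2 * l + 1)) ^ 3 -
      3 * Real.cos (Real.pi / 3 * (2 * l + 1))) := by
    rw [← Real.cos_three_mul, ← Real.cos_sub_pi]
    congr 1
    ring
  rw [h]
  generalize Real.cos (Real.pi / 3 * (2 * l + 1)) = c
  rw [← sq_eq_zero_iff (a := 2 * (4 + τ ^ 2) * c - (4 - τ ^ 2)), ← mul_eq_zero]
  constructor <;> intro h <;> linear_combination -h

theorem cos_pi_div_three_mul_two_mul_add_one (l : ℝ) :
    Real.cos (Real.pi / 3 * (2 * l + 1)) =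
      (Real.cos (Real.pi * l / 3) ^ 2 - Real.sin (Real.pi * l / 3) ^ 2) / 2 -
        Real.sqrt 3 * Real.sin (Real.pi * l / 3) * Real.cos (Real.pi * l / 3) := by
  have h : Real.pi / 3 * (2 * l + 1) = 2 * (Real.pi * l / 3) + Real.pi / 3 := by ring
  rw [h, Real.cos_add, Real.cos_two_mul', Real.sin_two_mul, Real.cos_pi_div_three,
    Real.sin_pi_div_three]
  ring

/-- complete solution family of the eigenvalue equation for the
spin-orbit operator of the symmetric star graph with three equally spaced edges
and equal interaction strength `τ`, in the generic case `τ ≠ ±2, ±2/√3`. -/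
theorem symmetric_three_edge_solutions
    (τ : ℝ) (h2 : τ ≠ 2) (h2' : τ ≠ -2)
    (h3 : τ ≠ 2 / Real.sqrt 3) (h3' : τ ≠ -(2 / Real.sqrt 3)) (lam : ℝ) :
    ((4 + τ ^ 2) ^ 3 * Real.cos (2 * Real.pi * lam) - (4 - τ ^ 2) ^ 3 =
        48 * (4 + τ ^ 2) * τ ^ 2 * Real.cos (Real.pi / 3 * (2 * lam + 1))) ↔
    ∃ k : ℤ,
      lam = 3 * k + 3 / Real.pi *
          Real.arctan ((6 - Real.sqrt 3 * τ) / (3 * τ + 2 * Real.sqrt 3)) ∨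
      lam = 3 * k + 3 / Real.pi *
          Real.arctan ((6 + Real.sqrt 3 * τ) / (2 * Real.sqrt 3 - 3 * τ)) ∨
      lam = 3 * k - 3 / Real.pi *
          Real.arctan ((12 + 3 * τ ^ 2 +
            Real.sqrt 3 * Real.sqrt (48 + 40 * τ ^ 2 + 3 * τ ^ 4)) / (8 * Real.sqrt 3)) ∨
      lam = 3 * k + 3 / Real.pi *
          Real.arctan ((-12 - 3 * τ ^ 2 +
            Real.sqrt 3 * Real.sqrt (48 + 40 * τ ^ 2 + 3 * τ ^ 4)) / (8 * Real.sqrt 3)) := by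
  have h3s : Real.sqrt 3 ^ 2 = 3 := Real.sq_sqrt (by norm_num)
  have h3pos : 0 < Real.sqrt 3 := by positivity
  have hDs : Real.sqrt (48 + 40 * τ ^ 2 + 3 * τ ^ 4) ^ 2 = 48 + 40 * τ ^ 2 + 3 * τ ^ 4 :=
    Real.sq_sqrt (by positivity)
  have hd1 : 3 * τ + 2 * Real.sqrt 3 ≠ 0 := fun h => h3' (by
    field_simp
    linear_combination Real.sqrt 3 / 3 * h - 2 / 3 * h3s)
  have hd2 : 2 * Real.sqrt 3 - 3 * τ ≠ 0 := fun h => h3 (by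
    field_simp
    linear_combination -(Real.sqrt 3 / 3) * h + 2 / 3 * h3s)
  have hneg (k : ℤ) (x : ℝ) : 3 * k - 3 / Real.pi * Real.arctan x =
      3 * k + 3 / Real.pi * Real.arctan (-x) := by
    rw [Real.arctan_neg]
    ring
  simp only [hneg, exists_or, exists_eq_add_arctan_iff]
  rw [eigenvalue_equation_iff_factors, cos_pi_div_three_mul_two_mul_add_one, ← or_assoc]
  have hSC := Real.sin_sq_add_cos_sq (Real.pi * lam / 3)
  generalize Real.sin (Real.pi * lam / 3) = S at *
  generalize Real.cos (Real.pi * lam / 3) = C at *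
  generalize Real.sqrt (48 + 40 * τ ^ 2 + 3 * τ ^ 4) = D at *
  generalize Real.sqrt 3 = r at *
  have h8 : 8 * r ≠ 0 := by positivity
  refine or_congr ?_ ?_
  · rw [div_mul_eq_mul_div, div_mul_eq_mul_div, eq_div_iff hd1, eq_div_iff hd2,
      ← sub_eq_zero (b := (6 - r * τ) * C), ← sub_eq_zero (b := (6 + r * τ) * C), ← mul_eq_zero]
    constructor <;> intro h
    · linear_combination 6 * h + 6 * (4 - τ ^ 2) * hSC + (4 * S ^ 2 - τ ^ 2 * C ^ 2) * h3s
    · linear_combination (h - (6 * (4 - τ ^ 2) * hSC + (4 * S ^ 2 - τ ^ 2 * C ^ 2) * h3s)) / 6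
  · rw [← neg_div, div_mul_eq_mul_div, div_mul_eq_mul_div, eq_div_iff h8, eq_div_iff h8,
      ← sub_eq_zero (b := -_ * C), ← sub_eq_zero (b := (-12 - _ + _) * C), ← mul_eq_zero]
    constructor <;> intro h
    · linear_combination -24 * h + 24 * (4 - τ ^ 2) * hSC + (64 * S ^ 2 - C ^ 2 * D ^ 2) * h3s
        - 3 * C ^ 2 * hDs
    · linear_combination -(h - (24 * (4 - τ ^ 2) * hSC + (64 * S ^ 2 - C ^ 2 * D ^ 2) * h3s
        - 3 * C ^ 2 * hDs)) / 24
end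
end

section
/- Let τ ∈ ℝ with |τ| ≥ 2√3, and set p := 1 − τ²/4 and m := 1 + τ²/4. Then for every λ ∈ (−1/2, 0), (p/m)·sin(−4πλ/3 + π/3) < 0 < sin((π/3)(2λ+1)) + sin(π(2λ+1)); in particular, the equation (p/m)·sin(−4πλ/3 + π/3) = sin((π/3)(2λ+1)) + sin(π(2λ+1)) has no solution λ ∈ (−1/2, 0). -/
noncomputable section

/-- for `|τ| ≥ 2√3` the necessary condition for a double
eigenvalue of the spin-orbit operator `J₃` of the symmetric three-edge star
graph fails on `(−1/2, 0)`: the left-hand side is negative while the right-hand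
side is positive, so the equation has no solution there. -/
theorem symmetric_three_edge_no_double_eigenvalue
    (τ : ℝ) (hτ : 2 * Real.sqrt 3 ≤ |τ|) :
    let p : ℝ := 1 - τ ^ 2 / 4
    let m : ℝ := 1 + τ ^ 2 / 4
    (∀ lam ∈ Set.Ioo (-1/2 : ℝ) 0,
      p / m * Real.sin (-(4 * Real.pi * lam) / 3 + Real.pi / 3) < 0 ∧
      0 < Real.sin (Real.pi / 3 * (2 * lam + 1)) + Real.sin (Real.pi * (2 * lam + 1))) ∧
    ∀ lam ∈ Set.Ioo (-1/2 : ℝ) 0,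
      p / m * Real.sin (-(4 * Real.pi * lam) / 3 + Real.pi / 3) ≠
        Real.sin (Real.pi / 3 * (2 * lam + 1)) + Real.sin (Real.pi * (2 * lam + 1)) := by
  intro p m
  have hτ_sq : 12 ≤ τ ^ 2 := by
    have h := pow_le_pow_left₀ (by positivity) hτ 2
    rw [mul_pow, Real.sq_sqrt (by norm_num), sq_abs] at h
    linarith
  have hpm : p / m < 0 := div_neg_of_neg_of_pos (by grind) (by positivity)
  have hsign : ∀ lam ∈ Set.Ioo (-1/2 : ℝ) 0,
      p / m * Real.sin (-(4 * Real.pi * lam) / 3 + Real.pi / 3) < 0 ∧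
      0 < Real.sin (Real.pi / 3 * (2 * lam + 1)) + Real.sin (Real.pi * (2 * lam + 1)) := by
    rintro lam ⟨hlower, hupper⟩
    have hpi := Real.pi_pos
    have hleft : 0 < Real.pi * (2 * lam + 1) := mul_pos hpi (by linarith)
    have hright : 0 < Real.pi * -lam := mul_pos hpi (by linarith)
    refine ⟨mul_neg_of_neg_of_pos hpm (Real.sin_pos_of_pos_of_lt_pi ?_ ?_),
      add_pos (Real.sin_pos_of_pos_of_lt_pi ?_ ?_) (Real.sin_pos_of_pos_of_lt_pi ?_ ?_)⟩ <;>
    linarith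
  exact ⟨hsign, fun lam hlam => ((hsign lam hlam).1.trans (hsign lam hlam).2).ne⟩
end
end

section
/- Let λ̃ ∈ ℝ with λ̃ ≥ 0, and let ψ = (ψ₁, ψ₂) with ψ₁, ψ₂ : (0, ∞) → ℂ smooth functions with compact support in (0, ∞). Define Q(ψ) := ∫₀^∞ |−ψ₂'(r) − λ̃·ψ₂(r)/r|² dr + ∫₀^∞ |ψ₁'(r) − λ̃·ψ₁(r)/r|² dr + ∫₀^∞ (|ψ₁(r)|² + |ψ₂(r)|²) dr and ‖ψ‖²_{H¹} := ∫₀^∞ (|ψ₁'(r)|² + |ψ₂'(r)|² + |ψ₁(r)|² + |ψ₂(r)|²) dr. Then min{1, (1 − 2λ̃)²}·‖ψ‖²_{H¹} ≤ Q(ψ) ≤ (1 + 2λ̃)²·‖ψ‖²_{H¹}. -/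
noncomputable section

open MeasureTheory Set Filter Topology

/-- A continuous function supported in `(0, ∞)` stays continuous after division by `r`. -/
theorem continuous_inv_smul_of_tsupport_subset_Ioi {ψ : ℝ → ℂ} (h : Continuous ψ)
    (hs : tsupport ψ ⊆ Ioi 0) : Continuous fun r : ℝ => r⁻¹ • ψ r := by
  refine continuous_iff_continuousAt.2 fun r => ?_
  by_cases hr : r = 0
  · have h0 : ψ =ᶠ[𝓝 r] 0 := by
      rw [← notMem_tsupport_iff_eventuallyEq]
      intro hmem
      exact (hs hmem).ne' hr
    refine (continuousAt_const (y := (0 : ℂ))).congr ?_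
    filter_upwards [h0] with x hx
    simp [hx]
  · exact (continuousAt_inv₀ hr).smul h.continuousAt

theorem integrable_norm_sq_of_hasCompactSupport {f : ℝ → ℂ} (hf : Continuous f)
    (hc : HasCompactSupport f) : Integrable fun r => ‖f r‖ ^ 2 := by
  refine (hf.norm.pow 2).integrable_of_hasCompactSupport (hc.mono ?_)
  intro r hr h0
  refine hr ?_
  simp [h0]

/-- The pointwise expansion of `‖w - c v / r‖²`; for `v = ψ r`, `w = ψ' r` the last bracket is
the derivative of `‖ψ r‖² / r`. -/
theorem norm_sub_mul_div_sq (c r : ℝ) (v w : ℂ) :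
    ‖w - (c : ℂ) * v / (r : ℂ)‖ ^ 2 =
      ‖w‖ ^ 2 + (c ^ 2 - c) * ‖r⁻¹ • v‖ ^ 2
        - c * (2 * inner ℝ (r⁻¹ • v) w - ‖r⁻¹ • v‖ ^ 2) := by
  have h : (c : ℂ) * v / (r : ℂ) = c • (r⁻¹ • v) := by
    simp only [Complex.real_smul, Complex.ofReal_inv]
    ring
  rw [h, norm_sub_sq_real, inner_smul_right, norm_smul c, mul_pow, Real.norm_eq_abs, sq_abs,
    real_inner_comm]
  ring

/-- Integration by parts: `∫ |ψ' - c ψ / r|² = ∫ |ψ'|² + (c² - c) ∫ |ψ / r|²`. -/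
theorem integral_norm_deriv_sub_mul_div_sq {ψ : ℝ → ℂ} (h : ContDiff ℝ 1 ψ)
    (hc : HasCompactSupport ψ) (hs : tsupport ψ ⊆ Ioi 0) (c : ℝ) :
    ∫ r in Ioi (0 : ℝ), ‖deriv ψ r - (c : ℂ) * ψ r / (r : ℂ)‖ ^ 2 =
      (∫ r in Ioi (0 : ℝ), ‖deriv ψ r‖ ^ 2)
        + (c ^ 2 - c) * ∫ r in Ioi (0 : ℝ), ‖r⁻¹ • ψ r‖ ^ 2 := by
  have hu := continuous_inv_smul_of_tsupport_subset_Ioi h.continuous hs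
  have huc : HasCompactSupport fun r : ℝ => r⁻¹ • ψ r := by
    refine hc.mono ?_
    intro r hr h0
    refine hr ?_
    simp only [h0, smul_zero]
  have hd : Continuous (deriv ψ) := h.continuous_deriv le_rfl
  have hD := integrable_norm_sq_of_hasCompactSupport hd hc.deriv
  have hW := integrable_norm_sq_of_hasCompactSupport hu huc
  have hI : Integrable fun r : ℝ => (inner ℝ (r⁻¹ • ψ r) (deriv ψ r) : ℝ) := by
    refine (hu.inner hd).integrable_of_hasCompactSupport (huc.mono ?_)
    intro r hr h0
    refine hr ?_
    have h0' : r⁻¹ • ψ r = 0 := h0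
    simp only [h0', inner_zero_left]
  have hN : Integrable fun r : ℝ =>
      2 * (inner ℝ (r⁻¹ • ψ r) (deriv ψ r) : ℝ) - ‖r⁻¹ • ψ r‖ ^ 2 := (hI.const_mul 2).sub hW
  have hcross : ∫ r in Ioi (0 : ℝ),
      (2 * (inner ℝ (r⁻¹ • ψ r) (deriv ψ r) : ℝ) - ‖r⁻¹ • ψ r‖ ^ 2) = 0 := by
    have hprim : HasCompactSupport fun r : ℝ => (inner ℝ (r⁻¹ • ψ r) (ψ r) : ℝ) := by
      refine hc.mono ?_
      intro r hr h0
      refine hr ?_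
      simp only [h0, inner_zero_right]
    have key := integral_Ioi_of_hasDerivAt_of_tendsto (a := 0) (m := 0)
      (f := fun r : ℝ => (inner ℝ (r⁻¹ • ψ r) (ψ r) : ℝ))
      (hu.inner h.continuous).continuousWithinAt (fun r hr => ?_) hN.integrableOn
      (hprim.is_zero_at_infty.mono_left atTop_le_cocompact)
    · simpa using key
    · have hr0 : r ≠ 0 := (mem_Ioi.1 hr).ne'
      have hψ : HasDerivAt ψ (deriv ψ r) r :=
        (h.differentiable one_ne_zero r).hasDerivAt
      refine (((hasDerivAt_inv hr0).smul hψ).inner ℝ hψ).congr_deriv ?_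
      simp only [Pi.smul_apply', inner_add_left, real_inner_smul_left, norm_smul, mul_pow,
        real_inner_self_eq_norm_sq, Real.norm_eq_abs, sq_abs]
      rw [real_inner_comm (ψ r)]
      field_simp
      ring
  simp_rw [norm_sub_mul_div_sq]
  rw [integral_sub (hD.fun_add (hW.const_mul (c ^ 2 - c))).integrableOn (hN.const_mul c).integrableOn,
    integral_add hD.integrableOn (hW.const_mul (c ^ 2 - c)).integrableOn, integral_const_mul,
    integral_const_mul, hcross]
  ring

/-- The one-dimensional Hardy inequality. -/
theorem integral_norm_inv_smul_sq_le_four_mul {ψ : ℝ → ℂ} (h : ContDiff ℝ 1 ψ)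
    (hc : HasCompactSupport ψ) (hs : tsupport ψ ⊆ Ioi 0) :
    ∫ r in Ioi (0 : ℝ), ‖r⁻¹ • ψ r‖ ^ 2 ≤ 4 * ∫ r in Ioi (0 : ℝ), ‖deriv ψ r‖ ^ 2 := by
  have key := integral_norm_deriv_sub_mul_div_sq h hc hs (1 / 2)
  have hnonneg : 0 ≤ ∫ r in Ioi (0 : ℝ),
      ‖deriv ψ r - ((1 / 2 : ℝ) : ℂ) * ψ r / (r : ℂ)‖ ^ 2 :=
    integral_nonneg fun r => by positivity
  rw [key] at hnonneg
  linarith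

/-- two-sided estimate between the squared graph norm `Q` of the
half-line Dirac operator with off-diagonal Coulomb potential (with `λ̃ ≥ 0`) and
the `H¹` norm, for smooth functions compactly supported in `(0, ∞)`. -/
theorem halfline_dirac_graph_norm_equivalence
    (lam : ℝ) (hlam : 0 ≤ lam) (ψ₁ ψ₂ : ℝ → ℂ)
    (h₁ : ContDiff ℝ (⊤ : ℕ∞) ψ₁) (h₂ : ContDiff ℝ (⊤ : ℕ∞) ψ₂)
    (hc₁ : HasCompactSupport ψ₁) (hc₂ : HasCompactSupport ψ₂)
    (hs₁ : tsupport ψ₁ ⊆ Set.Ioi 0) (hs₂ : tsupport ψ₂ ⊆ Set.Ioi 0) :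
    let Q : ℝ :=
      (∫ r in Set.Ioi (0 : ℝ),
          ‖-deriv ψ₂ r - (lam : ℂ) * ψ₂ r / (r : ℂ)‖ ^ 2) +
      (∫ r in Set.Ioi (0 : ℝ),
          ‖deriv ψ₁ r - (lam : ℂ) * ψ₁ r / (r : ℂ)‖ ^ 2) +
      (∫ r in Set.Ioi (0 : ℝ), (‖ψ₁ r‖ ^ 2 + ‖ψ₂ r‖ ^ 2))
    let H1 : ℝ :=
      ∫ r in Set.Ioi (0 : ℝ),
        (‖deriv ψ₁ r‖ ^ 2 + ‖deriv ψ₂ r‖ ^ 2 + ‖ψ₁ r‖ ^ 2 + ‖ψ₂ r‖ ^ 2)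
    min 1 ((1 - 2 * lam) ^ 2) * H1 ≤ Q ∧ Q ≤ (1 + 2 * lam) ^ 2 * H1 := by
  intro Q H1
  have g₁ : ContDiff ℝ 1 ψ₁ := h₁.of_le (by exact_mod_cast le_top)
  have g₂ : ContDiff ℝ 1 ψ₂ := h₂.of_le (by exact_mod_cast le_top)
  have iD₁ := (integrable_norm_sq_of_hasCompactSupport (g₁.continuous_deriv le_rfl)
    hc₁.deriv).integrableOn (s := Ioi 0)
  have iD₂ := (integrable_norm_sq_of_hasCompactSupport (g₂.continuous_deriv le_rfl)
    hc₂.deriv).integrableOn (s := Ioi 0)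
  have iL₁ := (integrable_norm_sq_of_hasCompactSupport g₁.continuous hc₁).integrableOn (s := Ioi 0)
  have iL₂ := (integrable_norm_sq_of_hasCompactSupport g₂.continuous hc₂).integrableOn (s := Ioi 0)
  have hardy₁ := integral_norm_inv_smul_sq_le_four_mul g₁ hc₁ hs₁
  have hardy₂ := integral_norm_inv_smul_sq_le_four_mul g₂ hc₂ hs₂
  have e₁ := integral_norm_deriv_sub_mul_div_sq g₁ hc₁ hs₁ lam
  have e₂ : ∫ r in Ioi (0 : ℝ), ‖-deriv ψ₂ r - (lam : ℂ) * ψ₂ r / (r : ℂ)‖ ^ 2 =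
      (∫ r in Ioi (0 : ℝ), ‖deriv ψ₂ r‖ ^ 2)
        + (lam ^ 2 + lam) * ∫ r in Ioi (0 : ℝ), ‖r⁻¹ • ψ₂ r‖ ^ 2 := by
    have e := integral_norm_deriv_sub_mul_div_sq g₂ hc₂ hs₂ (-lam)
    rw [neg_sq, sub_neg_eq_add] at e
    rw [← e]
    refine integral_congr_ae (Eventually.of_forall fun r => ?_)
    change ‖_‖ ^ 2 = ‖_‖ ^ 2
    rw [← norm_neg]
    congr 2
    push_cast
    ring
  have eQ : Q = _ + _ + ∫ r in Ioi (0 : ℝ), (‖ψ₁ r‖ ^ 2 + ‖ψ₂ r‖ ^ 2) :=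
    congrArg₂ (· + ·) (congrArg₂ (· + ·) e₂ e₁) rfl
  rw [integral_add iL₁ iL₂] at eQ
  have eH : H1 = (∫ r in Ioi (0 : ℝ), ‖deriv ψ₁ r‖ ^ 2) + (∫ r in Ioi (0 : ℝ), ‖deriv ψ₂ r‖ ^ 2)
      + (∫ r in Ioi (0 : ℝ), ‖ψ₁ r‖ ^ 2) + ∫ r in Ioi (0 : ℝ), ‖ψ₂ r‖ ^ 2 := by
    change (∫ r in Ioi (0 : ℝ), _) = _
    rw [integral_add ((iD₁.fun_add iD₂).fun_add iL₁) iL₂, integral_add (iD₁.fun_add iD₂) iL₁,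
      integral_add iD₁ iD₂]
  have nonneg (f : ℝ → ℂ) : 0 ≤ ∫ r in Ioi (0 : ℝ), ‖f r‖ ^ 2 :=
    integral_nonneg fun r => by positivity
  have pD₁ := nonneg (deriv ψ₁)
  have pD₂ := nonneg (deriv ψ₂)
  have pL₁ := nonneg ψ₁
  have pL₂ := nonneg ψ₂
  have pW₁ := nonneg fun r => r⁻¹ • ψ₁ r
  have pW₂ := nonneg fun r => r⁻¹ • ψ₂ r
  rw [eQ, eH]
  generalize (∫ r in Ioi (0 : ℝ), ‖deriv ψ₁ r‖ ^ 2) = D₁ at *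
  generalize (∫ r in Ioi (0 : ℝ), ‖deriv ψ₂ r‖ ^ 2) = D₂ at *
  generalize (∫ r in Ioi (0 : ℝ), ‖ψ₁ r‖ ^ 2) = L₁ at *
  generalize (∫ r in Ioi (0 : ℝ), ‖ψ₂ r‖ ^ 2) = L₂ at *
  generalize (∫ r in Ioi (0 : ℝ), ‖r⁻¹ • ψ₁ r‖ ^ 2) = W₁ at *
  generalize (∫ r in Ioi (0 : ℝ), ‖r⁻¹ • ψ₂ r‖ ^ 2) = W₂ at *
  have hsum : 0 ≤ lam ^ 2 + lam := by positivity
  constructor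
  · have m₁ : min 1 ((1 - 2 * lam) ^ 2) ≤ 1 := min_le_left _ _
    have m₂ : min 1 ((1 - 2 * lam) ^ 2) ≤ (1 - 2 * lam) ^ 2 := min_le_right _ _
    generalize min 1 ((1 - 2 * lam) ^ 2) = m at *
    have bD₁ : m * D₁ ≤ D₁ + (lam ^ 2 - lam) * W₁ := by
      rcases le_total lam 1 with hl | hl
      · have hneg : 0 ≤ lam - lam ^ 2 := by nlinarith
        nlinarith [mul_le_mul_of_nonneg_left hardy₁ hneg, mul_le_mul_of_nonneg_right m₂ pD₁]
      · have hpos : 0 ≤ lam ^ 2 - lam := by nlinarith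
        nlinarith [mul_nonneg hpos pW₁, mul_le_mul_of_nonneg_right m₁ pD₁]
    nlinarith [mul_nonneg hsum pW₂, mul_le_mul_of_nonneg_right m₁ pD₂,
      mul_le_mul_of_nonneg_right m₁ pL₁, mul_le_mul_of_nonneg_right m₁ pL₂]
  · nlinarith [mul_le_mul_of_nonneg_left hardy₁ hsum, mul_le_mul_of_nonneg_left hardy₂ hsum,
      mul_nonneg hlam pW₁, mul_nonneg hsum pL₁, mul_nonneg hsum pL₂]
end
end
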